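/- arXiv:0705.2205 — 5 statements merged into one kernel-verified Lean document; each statement's English description precedes it below -/
import Mathlib

section
/- For every finite set S with |S| = n ≥ 1 and every k ≥ 1, the number of compact Streett Safra trees over S with index k (counted up to the stated identification) is at most 2·n^n·(k+1)^{n(k+1)}·(n(k+1))!. -/
/-- A *compact Streett Safra tree* over a state set `S` with `|S| = n` and
index `k`.  Let `m = n(k+1)`.  As in the paper, the nodes are taken from
`V = Fin (2m)` and carry *names* in `[m] = {1,…,m}` via the naming function
`M`, a bijection from the set `N` of nodes onto `[|N|] = {1,…,|N|}` sending the
root to the name `1`.  Annotations are subsets of `Fin k` (representing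
`[k] = {1,…,k}`).  The parent function (defined on `N - {root}`) is encoded as
a total function that is the identity outside of its domain, the naming
function as a total function that is `0` outside of `N`, and the labeling and
annotation as total functions that are empty outside of `N`.  The requirement
that the label of a node equals the union of the labels of its sons applies to
the nodes that have sons. -/
structure CompactStreettSafraTree (S : Type) (n k : ℕ) where
  /-- the set of nodes `N` -/
  nodes : Finset (Fin (2 * (n * (k + 1))))
  /-- the root node (the node named `1`) -/
  root : Fin (2 * (n * (k + 1)))
  root_mem : root ∈ nodes
  /-- the naming function `M : N → [m]` -/
  name : Fin (2 * (n * (k + 1))) → ℕ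
  name_zero : ∀ v : Fin (2 * (n * (k + 1))), v ∉ nodes → name v = 0
  name_root : name root = 1
  /-- names are in `[m]` and in `[|N|]` -/
  name_mem : ∀ v ∈ nodes, 1 ≤ name v ∧ name v ≤ n * (k + 1) ∧ name v ≤ nodes.card
  /-- `M` is injective on `N` (hence a bijection from `N` onto `[|N|]`) -/
  name_inj : ∀ v ∈ nodes, ∀ u ∈ nodes, name v = name u → v = u
  /-- the parent function `p`, defined over `N - {root}` -/
  parent : Fin (2 * (n * (k + 1))) → Fin (2 * (n * (k + 1)))
  parent_id : ∀ v : Fin (2 * (n * (k + 1))), v ∉ nodes ∨ v = root → parent v = v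
  parent_mem : ∀ v ∈ nodes, v ≠ root → parent v ∈ nodes
  /-- `N` is a rooted tree: iterating the parent function reaches the root -/
  reaches_root : ∀ v ∈ nodes, ∃ m : ℕ, parent^[m] v = root
  /-- the labeling `l : N → 2^S` -/
  label : Fin (2 * (n * (k + 1))) → Set S
  label_empty : ∀ v : Fin (2 * (n * (k + 1))), v ∉ nodes → label v = ∅
  /-- every node has a nonempty label -/
  label_nonempty : ∀ v ∈ nodes, (label v).Nonempty
  /-- the label of every node (with sons) equals the union of the labels of its sons -/
  label_union : ∀ v ∈ nodes, (∃ u, u ∈ nodes ∧ u ≠ root ∧ parent u = v) →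
    label v = {s | ∃ u, u ∈ nodes ∧ u ≠ root ∧ parent u = v ∧ s ∈ label u}
  /-- the labels of two siblings are disjoint -/
  label_disj : ∀ v ∈ nodes, ∀ u ∈ nodes, v ≠ root → u ≠ root → v ≠ u →
    parent v = parent u → label v ∩ label u = ∅
  /-- the annotation `h : N → 2^{[k]}` -/
  ann : Fin (2 * (n * (k + 1))) → Set (Fin k)
  ann_empty : ∀ v : Fin (2 * (n * (k + 1))), v ∉ nodes → ann v = ∅
  /-- the root is annotated by `[k]` -/
  ann_root : ann root = Set.univ
  /-- the annotation of every node is contained in that of its parent -/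
  ann_sub : ∀ v ∈ nodes, v ≠ root → ann v ⊆ ann (parent v)
  /-- the annotation of a node misses at most one element of the annotation of
  its parent -/
  ann_miss : ∀ v ∈ nodes, v ≠ root → ∀ a b : Fin k,
    a ∈ ann (parent v) → a ∉ ann v → b ∈ ann (parent v) → b ∉ ann v → a = b
  /-- every node that is not a leaf has at least one son with strictly smaller
  annotation -/
  ann_strict : ∀ v ∈ nodes, (∃ u, u ∈ nodes ∧ u ≠ root ∧ parent u = v) →
    ∃ u, u ∈ nodes ∧ u ≠ root ∧ parent u = v ∧ ann u ⊂ ann v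
  /-- `e ∈ [m+1]` -/
  e : ℕ
  e_mem : 1 ≤ e ∧ e ≤ n * (k + 1) + 1
  /-- `f ∈ [m+1]` -/
  f : ℕ
  f_mem : 1 ≤ f ∧ f ≤ n * (k + 1) + 1

/-- The parenthood relation of a compact Streett Safra tree, transported along
the naming function: `a` is the name of the parent of the node named `b`. -/
def CompactStreettSafraTree.namedParent {S : Type} {n k : ℕ}
    (t : CompactStreettSafraTree S n k) : ℕ → ℕ → Prop :=
  fun a b => ∃ u, u ∈ t.nodes ∧ u ≠ t.root ∧ t.name u = b ∧ t.name (t.parent u) = a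

/-- The labeling of names of a compact Streett Safra tree. -/
def CompactStreettSafraTree.namedLabel {S : Type} {n k : ℕ}
    (t : CompactStreettSafraTree S n k) : ℕ → Set S :=
  fun a => {s | ∃ v, v ∈ t.nodes ∧ t.name v = a ∧ s ∈ t.label v}

/-- The annotation of names of a compact Streett Safra tree. -/
def CompactStreettSafraTree.namedAnn {S : Type} {n k : ℕ}
    (t : CompactStreettSafraTree S n k) : ℕ → Set (Fin k) :=
  fun a => {j | ∃ v, v ∈ t.nodes ∧ t.name v = a ∧ j ∈ t.ann v}

/-- The acceptance data of a compact Streett Safra tree: the value of `e` in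
case `e ≤ f`, and the value of `f` in case `f < e`. -/
def CompactStreettSafraTree.accData {S : Type} {n k : ℕ}
    (t : CompactStreettSafraTree S n k) : Bool × ℕ :=
  if t.e ≤ t.f then (true, t.e) else (false, t.f)

namespace CompactStreettSafraTree

variable {S : Type} {n k : ℕ}

/-- `v` is a node without sons. -/
def IsLeaf (t : CompactStreettSafraTree S n k) (v : Fin (2 * (n * (k + 1)))) : Prop :=
  v ∈ t.nodes ∧ ¬ ∃ u, u ∈ t.nodes ∧ u ≠ t.root ∧ t.parent u = v

lemma parent_root (t : CompactStreettSafraTree S n k) : t.parent t.root = t.root :=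
  t.parent_id _ (Or.inr rfl)

lemma parent_mem_nodes (t : CompactStreettSafraTree S n k) {v : Fin (2 * (n * (k + 1)))}
    (hv : v ∈ t.nodes) : t.parent v ∈ t.nodes := by
  by_cases h : v = t.root
  · rw [h, parent_root]; exact t.root_mem
  · exact t.parent_mem v hv h

lemma iterate_parent_root (t : CompactStreettSafraTree S n k) (a : ℕ) :
    t.parent^[a] t.root = t.root :=
  Function.iterate_fixed t.parent_root a

lemma label_subset_parent (t : CompactStreettSafraTree S n k) {v : Fin (2 * (n * (k + 1)))}
    (hv : v ∈ t.nodes) : t.label v ⊆ t.label (t.parent v) := by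
  by_cases h : v = t.root
  · rw [h, parent_root]
  · intro s hs
    rw [t.label_union (t.parent v) (t.parent_mem v hv h) ⟨v, hv, h, rfl⟩]
    exact ⟨v, hv, h, rfl, hs⟩

lemma label_subset_iterate (t : CompactStreettSafraTree S n k) (a : ℕ) :
    ∀ {v : Fin (2 * (n * (k + 1)))}, v ∈ t.nodes → t.label v ⊆ t.label (t.parent^[a] v) := by
  induction a with
  | zero => intro v _; exact subset_rfl
  | succ a ih =>
    intro v hv
    exact (t.label_subset_parent hv).trans (ih (t.parent_mem_nodes hv))

/-- Siblings that share a state coincide. -/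
lemma eq_of_sibling (t : CompactStreettSafraTree S n k) {u v : Fin (2 * (n * (k + 1)))} {s : S}
    (hu : u ∈ t.nodes) (hv : v ∈ t.nodes) (hur : u ≠ t.root) (hvr : v ≠ t.root)
    (hp : t.parent u = t.parent v) (hsu : s ∈ t.label u) (hsv : s ∈ t.label v) : u = v := by
  by_contra h
  have := t.label_disj u hu v hv hur hvr h hp
  exact (Set.mem_empty_iff_false s).1 (this ▸ ⟨hsu, hsv⟩)

lemma comparable_of_parent (t : CompactStreettSafraTree S n k) {u v : Fin (2 * (n * (k + 1)))}
    {s : S} (hu : u ∈ t.nodes) (hv : v ∈ t.nodes) (hur : u ≠ t.root)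
    (hsu : s ∈ t.label u) (hsv : s ∈ t.label v) (c : ℕ) (h : t.parent^[c] v = t.parent u) :
    (∃ c, t.parent^[c] u = v) ∨ ∃ c, t.parent^[c] v = u := by
  induction c with
  | zero => exact Or.inl ⟨1, h.symm⟩
  | succ c ih =>
    by_cases hw : t.parent^[c] v = t.root
    · apply ih
      rw [← h, Function.iterate_succ_apply', hw, parent_root]
    · right
      refine ⟨c, ?_⟩
      have hmem : ∀ a, t.parent^[a] v ∈ t.nodes := by
        intro a
        induction a with
        | zero => exact hv
        | succ a iha => rw [Function.iterate_succ_apply']; exact t.parent_mem_nodes iha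
      rw [Function.iterate_succ_apply'] at h
      exact t.eq_of_sibling (hmem c) hu hw hur h (t.label_subset_iterate c hv hsv) hsu

/-- Two nodes that share a state are comparable in the tree. -/
lemma comparable (t : CompactStreettSafraTree S n k) {u v : Fin (2 * (n * (k + 1)))}
    {s : S} (hu : u ∈ t.nodes) (hv : v ∈ t.nodes)
    (hsu : s ∈ t.label u) (hsv : s ∈ t.label v) :
    (∃ c, t.parent^[c] u = v) ∨ ∃ c, t.parent^[c] v = u := by
  obtain ⟨a, ha⟩ := t.reaches_root u hu
  induction a generalizing u with
  | zero =>
    obtain ⟨b, hb⟩ := t.reaches_root v hv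
    exact Or.inr ⟨b, hb.trans ha.symm⟩
  | succ a ih =>
    by_cases hur : u = t.root
    · obtain ⟨b, hb⟩ := t.reaches_root v hv
      exact Or.inr ⟨b, hb.trans hur.symm⟩
    · rcases ih (t.parent_mem_nodes hu) (t.label_subset_parent hu hsu) ha with ⟨c, hc⟩ | ⟨c, hc⟩
      · exact Or.inl ⟨c + 1, hc⟩
      · exact t.comparable_of_parent hu hv hur hsu hsv c hc

lemma ann_eq_diff (t : CompactStreettSafraTree S n k) {v : Fin (2 * (n * (k + 1)))} {x : Fin k}
    (hv : v ∈ t.nodes) (hr : v ≠ t.root) (hx : x ∈ t.ann (t.parent v)) (hx' : x ∉ t.ann v) :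
    t.ann v = t.ann (t.parent v) \ {x} := by
  ext y
  constructor
  · intro hy
    exact ⟨t.ann_sub v hv hr hy, fun h => hx' (h ▸ hy)⟩
  · rintro ⟨hy, hne⟩
    by_contra h
    exact hne (t.ann_miss v hv hr y x hy h hx hx')

lemma ncard_ann_add_one (t : CompactStreettSafraTree S n k) {v : Fin (2 * (n * (k + 1)))}
    {x : Fin k} (hv : v ∈ t.nodes) (hr : v ≠ t.root) (hx : x ∈ t.ann (t.parent v))
    (hx' : x ∉ t.ann v) : (t.ann v).ncard + 1 = (t.ann (t.parent v)).ncard := by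
  rw [t.ann_eq_diff hv hr hx hx']
  exact Set.ncard_sdiff_singleton_add_one hx

lemma ncard_ann_le (t : CompactStreettSafraTree S n k) (v : Fin (2 * (n * (k + 1)))) :
    (t.ann v).ncard ≤ k := by
  have := Set.ncard_le_card (t.ann v)
  simpa using this

/-- A choice of representative states: every node is represented by a state in its label, and
every node that is not a leaf shares its representative with a son of smaller annotation. -/
structure IsRep (t : CompactStreettSafraTree S n k) (rep : Fin (2 * (n * (k + 1))) → S) :
    Prop where
  mem : ∀ v ∈ t.nodes, rep v ∈ t.label v
  son : ∀ v ∈ t.nodes, (∃ u, u ∈ t.nodes ∧ u ≠ t.root ∧ t.parent u = v) →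
    ∃ u, u ∈ t.nodes ∧ u ≠ t.root ∧ t.parent u = v ∧ t.ann u ⊂ t.ann v ∧ rep u = rep v

lemma exists_isRep (t : CompactStreettSafraTree S n k) : ∃ rep, t.IsRep rep := by
  classical
  have hσ : ∀ v, ∃ w, (v ∈ t.nodes → w ∈ t.nodes ∧ t.label w ⊆ t.label v) ∧
      ((v ∈ t.nodes ∧ ∃ u, u ∈ t.nodes ∧ u ≠ t.root ∧ t.parent u = v) →
        w ≠ t.root ∧ t.parent w = v ∧ t.ann w ⊂ t.ann v) ∧
      (¬ (v ∈ t.nodes ∧ ∃ u, u ∈ t.nodes ∧ u ≠ t.root ∧ t.parent u = v) → w = v) := by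
    intro v
    by_cases h : v ∈ t.nodes ∧ ∃ u, u ∈ t.nodes ∧ u ≠ t.root ∧ t.parent u = v
    · obtain ⟨u, hu, hur, hp, ha⟩ := t.ann_strict v h.1 h.2
      exact ⟨u, fun _ => ⟨hu, hp ▸ t.label_subset_parent hu⟩, fun _ => ⟨hur, hp, ha⟩,
        fun h' => absurd h h'⟩
    · exact ⟨v, fun hv => ⟨hv, subset_rfl⟩, fun h' => absurd h' h, fun _ => rfl⟩
  choose σ hσ1 hσ2 hσ3 using hσ
  obtain ⟨s₀, -⟩ := t.label_nonempty t.root t.root_mem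
  have hρ : ∀ v, ∃ s, v ∈ t.nodes → s ∈ t.label v := by
    intro v
    by_cases hv : v ∈ t.nodes
    · obtain ⟨s, hs⟩ := t.label_nonempty v hv
      exact ⟨s, fun _ => hs⟩
    · exact ⟨s₀, fun h => absurd h hv⟩
  choose ρ hρ using hρ
  have hiter : ∀ a v, v ∈ t.nodes → σ^[a] v ∈ t.nodes ∧ t.label (σ^[a] v) ⊆ t.label v := by
    intro a
    induction a with
    | zero => intro v hv; exact ⟨hv, subset_rfl⟩
    | succ a ih =>
      intro v hv
      obtain ⟨h1, h2⟩ := ih (σ v) (hσ1 v hv).1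
      exact ⟨h1, h2.trans (hσ1 v hv).2⟩
  have hfix : ∀ a v, σ (σ^[a] v) = σ^[a] v ∨ (t.ann (σ^[a] v)).ncard + a ≤ k := by
    intro a v
    induction a with
    | zero => exact Or.inr (t.ncard_ann_le v)
    | succ a ih =>
      rw [Function.iterate_succ_apply']
      rcases ih with h | h
      · left; rw [h, h]
      · by_cases hw : σ^[a] v ∈ t.nodes ∧
            ∃ u, u ∈ t.nodes ∧ u ≠ t.root ∧ t.parent u = σ^[a] v
        · right
          have := Set.ncard_lt_ncard (hσ2 _ hw).2.2
          omega
        · left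
          rw [hσ3 _ hw, hσ3 _ hw]
  have hfixed : ∀ v, σ (σ^[k + 1] v) = σ^[k + 1] v := by
    intro v
    rcases hfix (k + 1) v with h | h
    · exact h
    · omega
  refine ⟨fun v => ρ (σ^[k + 1] v), ⟨?_, ?_⟩⟩
  · intro v hv
    obtain ⟨h1, h2⟩ := hiter (k + 1) v hv
    exact h2 (hρ _ h1)
  · intro v hv hs
    obtain ⟨h1, h2, h3⟩ := hσ2 v ⟨hv, hs⟩
    refine ⟨σ v, (hσ1 v hv).1, h1, h2, h3, ?_⟩
    rw [← Function.iterate_succ_apply, Function.iterate_succ_apply', hfixed]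

namespace IsRep

variable {t : CompactStreettSafraTree S n k} {rep : Fin (2 * (n * (k + 1))) → S}

lemma of_mem_label (h : t.IsRep rep) {v : Fin (2 * (n * (k + 1)))} (hv : v ∈ t.nodes)
    (hr : v ≠ t.root) (hs : rep (t.parent v) ∈ t.label v) :
    rep v = rep (t.parent v) ∧ t.ann v ⊂ t.ann (t.parent v) := by
  obtain ⟨y, hy, hyr, hp, ha, hrep⟩ := h.son _ (t.parent_mem_nodes hv) ⟨v, hv, hr, rfl⟩
  have : y = v := t.eq_of_sibling hy hv hyr hr hp (hrep ▸ h.mem y hy) hs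
  subst this
  exact ⟨hrep, ha⟩

lemma of_iterate (h : t.IsRep rep) {u : Fin (2 * (n * (k + 1)))} (c : ℕ) :
    ∀ {v : Fin (2 * (n * (k + 1)))}, v ∈ t.nodes → t.parent^[c] v = u → v ≠ u →
      rep u ∈ t.label v →
      rep v = rep u ∧ v ≠ t.root ∧ rep (t.parent v) = rep u ∧
        (t.ann v).ncard < (t.ann u).ncard := by
  induction c with
  | zero => intro v _ h1 h2; exact absurd h1 h2
  | succ c ih =>
    intro v hv hc hne hs
    have hr : v ≠ t.root := by
      intro hr
      rw [hr, iterate_parent_root] at hc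
      exact hne (hr.trans hc)
    by_cases hw : t.parent v = u
    · subst hw
      obtain ⟨h1, h2⟩ := h.of_mem_label hv hr hs
      exact ⟨h1, hr, rfl, Set.ncard_lt_ncard h2⟩
    · obtain ⟨h1, -, -, h4⟩ := ih (t.parent_mem_nodes hv) hc hw (t.label_subset_parent hv hs)
      obtain ⟨h5, h6⟩ := h.of_mem_label hv hr (h1.symm ▸ hs)
      exact ⟨h5.trans h1, hr, h1, (Set.ncard_lt_ncard h6).trans h4⟩

/-- A node is determined by its representative and the size of its annotation. -/
lemma eq_of_ncard (h : t.IsRep rep) {u v : Fin (2 * (n * (k + 1)))} (hu : u ∈ t.nodes)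
    (hv : v ∈ t.nodes) (hrep : rep u = rep v) (hc : (t.ann u).ncard = (t.ann v).ncard) :
    u = v := by
  by_contra hne
  rcases t.comparable hu hv (h.mem u hu) (hrep ▸ h.mem v hv) with ⟨c, hc'⟩ | ⟨c, hc'⟩
  · have := (h.of_iterate c hu hc' hne (hrep ▸ h.mem u hu)).2.2.2
    omega
  · have := (h.of_iterate c hv hc' (Ne.symm hne) (hrep ▸ h.mem v hv)).2.2.2
    omega

end IsRep

/-- `v` is the topmost node with its representative. -/
def IsHead (t : CompactStreettSafraTree S n k) (rep : Fin (2 * (n * (k + 1))) → S)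
    (v : Fin (2 * (n * (k + 1)))) : Prop :=
  v ∈ t.nodes ∧ (v = t.root ∨ rep (t.parent v) ≠ rep v)

namespace IsRep

variable {t : CompactStreettSafraTree S n k} {rep : Fin (2 * (n * (k + 1))) → S}

lemma head_unique (h : t.IsRep rep) {u v : Fin (2 * (n * (k + 1)))} (hu : t.IsHead rep u)
    (hv : t.IsHead rep v) (hrep : rep u = rep v) : u = v := by
  by_contra hne
  rcases t.comparable hu.1 hv.1 (h.mem u hu.1) (hrep ▸ h.mem v hv.1) with ⟨c, hc⟩ | ⟨c, hc⟩
  · obtain ⟨h1, h2, h3, -⟩ := h.of_iterate c hu.1 hc hne (hrep ▸ h.mem u hu.1)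
    exact hu.2.elim h2 fun h4 => h4 (h3.trans h1.symm)
  · obtain ⟨h1, h2, h3, -⟩ := h.of_iterate c hv.1 hc (Ne.symm hne) (hrep ▸ h.mem v hv.1)
    exact hv.2.elim h2 fun h4 => h4 (h3.trans h1.symm)

lemma exists_head {v : Fin (2 * (n * (k + 1)))} (hv : v ∈ t.nodes) :
    ∃ u, t.IsHead rep u ∧ rep u = rep v ∧ t.ann v ⊆ t.ann u := by
  obtain ⟨a, ha⟩ := t.reaches_root v hv
  induction a generalizing v with
  | zero => exact ⟨v, ⟨hv, Or.inl ha⟩, rfl, subset_rfl⟩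
  | succ a ih =>
    by_cases hh : v = t.root ∨ rep (t.parent v) ≠ rep v
    · exact ⟨v, ⟨hv, hh⟩, rfl, subset_rfl⟩
    · push Not at hh
      obtain ⟨u, h1, h2, h3⟩ := ih (t.parent_mem_nodes hv) ha
      exact ⟨u, h1, h2.trans hh.2, (t.ann_sub v hv hh.1).trans h3⟩

lemma ann_subset_head (h : t.IsRep rep) {u v : Fin (2 * (n * (k + 1)))} (hu : t.IsHead rep u)
    (hv : v ∈ t.nodes) (hrep : rep u = rep v) : t.ann v ⊆ t.ann u := by
  obtain ⟨w, h1, h2, h3⟩ := exists_head (rep := rep) hv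
  rwa [h.head_unique hu h1 (hrep.trans h2.symm)]

lemma ann_ssubset_of_not_head (h : t.IsRep rep) {v : Fin (2 * (n * (k + 1)))} (hv : v ∈ t.nodes)
    (hr : v ≠ t.root) (hrep : rep (t.parent v) = rep v) : t.ann v ⊂ t.ann (t.parent v) :=
  (h.of_mem_label hv hr (hrep ▸ h.mem v hv)).2

end IsRep

lemma eq_of_iterate_isLeaf (t : CompactStreettSafraTree S n k) {u v : Fin (2 * (n * (k + 1)))}
    (hu : u ∈ t.nodes) (hv : t.IsLeaf v) (c : ℕ) (hc : t.parent^[c] u = v) : u = v := by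
  induction c with
  | zero => exact hc
  | succ c ih =>
    have hmem : t.parent^[c] u ∈ t.nodes := by
      clear hc ih
      induction c with
      | zero => exact hu
      | succ a iha => rw [Function.iterate_succ_apply']; exact t.parent_mem_nodes iha
    rw [Function.iterate_succ_apply'] at hc
    by_cases hw : t.parent^[c] u = t.root
    · apply ih
      rw [← hc, hw, parent_root]
    · exact absurd ⟨_, hmem, hw, hc⟩ hv.2

/-- Every node that contains a state of a leaf lies above this leaf. -/
lemma exists_iterate_of_isLeaf (t : CompactStreettSafraTree S n k)
    {u v : Fin (2 * (n * (k + 1)))} {s : S} (hu : u ∈ t.nodes) (hv : t.IsLeaf v)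
    (hsu : s ∈ t.label u) (hsv : s ∈ t.label v) : ∃ c, t.parent^[c] v = u := by
  rcases t.comparable hu hv.1 hsu hsv with ⟨c, hc⟩ | h
  · exact ⟨0, (t.eq_of_iterate_isLeaf hu hv c hc).symm⟩
  · exact h

lemma isLeaf_unique (t : CompactStreettSafraTree S n k) {u v : Fin (2 * (n * (k + 1)))} {s : S}
    (hu : t.IsLeaf u) (hv : t.IsLeaf v) (hsu : s ∈ t.label u) (hsv : s ∈ t.label v) : u = v := by
  obtain ⟨c, hc⟩ := t.exists_iterate_of_isLeaf hu.1 hv hsu hsv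
  exact (t.eq_of_iterate_isLeaf hv.1 hu c hc).symm

lemma exists_isLeaf (t : CompactStreettSafraTree S n k) {v : Fin (2 * (n * (k + 1)))} {s : S}
    (hv : v ∈ t.nodes) (hs : s ∈ t.label v) : ∃ u, t.IsLeaf u ∧ s ∈ t.label u := by
  classical
  obtain ⟨u, hu, hmax⟩ := Finset.exists_max_image (t.nodes.filter fun u => s ∈ t.label u)
    (fun u => sInf {a | t.parent^[a] u = t.root}) ⟨v, by simp [hv, hs]⟩
  rw [Finset.mem_filter] at hu
  refine ⟨u, ⟨hu.1, fun hson => ?_⟩, hu.2⟩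
  have hs' := hu.2
  rw [t.label_union u hu.1 hson] at hs'
  obtain ⟨w, hw, hwr, hp, hsw⟩ := hs'
  have h1 := hmax w (by simp [hw, hsw])
  have h2 : sInf {a | t.parent^[a] w = t.root} ∈ {a | t.parent^[a] w = t.root} :=
    Nat.sInf_mem (t.reaches_root w hw)
  generalize sInf {a | t.parent^[a] w = t.root} = d at h1 h2
  cases d with
  | zero => exact hwr h2
  | succ d =>
    have h3 : t.parent^[d] u = t.root := by
      rw [← hp]; exact h2
    have h4 : sInf {a | t.parent^[a] u = t.root} ≤ d := Nat.sInf_le h3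
    omega

lemma IsRep.exists_isLeaf {t : CompactStreettSafraTree S n k}
    {rep : Fin (2 * (n * (k + 1))) → S} (h : t.IsRep rep) {v : Fin (2 * (n * (k + 1)))}
    (hv : v ∈ t.nodes) : ∃ u, t.IsLeaf u ∧ rep u = rep v := by
  classical
  obtain ⟨u, hu, hmin⟩ := Finset.exists_min_image (t.nodes.filter fun u => rep u = rep v)
    (fun u => (t.ann u).ncard) ⟨v, by simp [hv]⟩
  rw [Finset.mem_filter] at hu
  refine ⟨u, ⟨hu.1, fun hson => ?_⟩, hu.2⟩
  obtain ⟨w, hw, -, -, ha, hr⟩ := h.son u hu.1 hson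
  have := hmin w (by simp [hw, hr, hu.2])
  have := Set.ncard_lt_ncard ha
  omega

/-- `c` records the tree structure: to a representative `s` it assigns the position of the parent
of the topmost node represented by `s` (its representative and the size of its annotation), whether
this topmost node has a smaller annotation than its parent, and the annotation elements removed on
the way down; to a state that is not a representative it assigns the representative of the leaf
that contains it. -/
structure IsCode (t : CompactStreettSafraTree S n k) (rep : Fin (2 * (n * (k + 1))) → S)
    (c : S → S × Option (Fin k × Bool × (Fin k → Option (Fin k)))) : Prop where
  head : ∀ v, t.IsHead rep v → ∃ i b g, c (rep v) = (rep (t.parent v), some (i, b, g)) ∧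
    (i : ℕ) + 1 = (t.ann (t.parent v)).ncard ∧ (b = true ↔ t.ann v ≠ t.ann (t.parent v))
  exists_head : ∀ s p i b g, c s = (p, some (i, b, g)) → ∃ v, t.IsHead rep v ∧ rep v = s
  removed : ∀ s p i b g, c s = (p, some (i, b, g)) → ∀ l x, g l = some x ↔
    ∃ u, u ∈ t.nodes ∧ u ≠ t.root ∧ rep u = s ∧ x ∈ t.ann (t.parent u) ∧ x ∉ t.ann u ∧
      (l : ℕ) + 1 = (t.ann (t.parent u)).ncard
  leaf : ∀ v, t.IsLeaf v → ∀ s, s ∈ t.label v ↔ s = rep v ∨ c s = (rep v, none)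

lemma IsRep.exists_isCode {t : CompactStreettSafraTree S n k}
    {rep : Fin (2 * (n * (k + 1))) → S} (h : t.IsRep rep) (hk : 1 ≤ k) :
    ∃ c, t.IsCode rep c := by
  classical
  have hg : ∀ s : S, ∃ g : Fin k → Option (Fin k), ∀ l x, g l = some x ↔
      ∃ u, u ∈ t.nodes ∧ u ≠ t.root ∧ rep u = s ∧ x ∈ t.ann (t.parent u) ∧ x ∉ t.ann u ∧
        (l : ℕ) + 1 = (t.ann (t.parent u)).ncard := by
    intro s
    have : ∀ l : Fin k, ∃ o : Option (Fin k), ∀ x, o = some x ↔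
        ∃ u, u ∈ t.nodes ∧ u ≠ t.root ∧ rep u = s ∧ x ∈ t.ann (t.parent u) ∧ x ∉ t.ann u ∧
          (l : ℕ) + 1 = (t.ann (t.parent u)).ncard := by
      intro l
      by_cases hx : ∃ x u, u ∈ t.nodes ∧ u ≠ t.root ∧ rep u = s ∧ x ∈ t.ann (t.parent u) ∧
          x ∉ t.ann u ∧ (l : ℕ) + 1 = (t.ann (t.parent u)).ncard
      · obtain ⟨x, u, hu, hur, hs, hx1, hx2, hl⟩ := hx
        refine ⟨some x, fun y => ⟨?_, ?_⟩⟩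
        · intro hy
          obtain rfl := Option.some.inj hy
          exact ⟨u, hu, hur, hs, hx1, hx2, hl⟩
        · rintro ⟨w, hw, hwr, hs', hy1, hy2, hl'⟩
          have e1 := t.ncard_ann_add_one hu hur hx1 hx2
          have e2 := t.ncard_ann_add_one hw hwr hy1 hy2
          obtain rfl := h.eq_of_ncard hu hw (hs.trans hs'.symm) (by omega)
          rw [t.ann_miss u hu hur x y hx1 hx2 hy1 hy2]
      · refine ⟨none, fun x => ⟨fun h' => by simp at h', fun h' => absurd ⟨x, h'⟩ hx⟩⟩
    choose g hg using this
    exact ⟨g, hg⟩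
  choose g hg using hg
  have hc : ∀ s : S, ∃ d : S × Option (Fin k × Bool × (Fin k → Option (Fin k))),
      (∀ v, t.IsHead rep v → rep v = s → ∃ i b, d = (rep (t.parent v), some (i, b, g s)) ∧
        (i : ℕ) + 1 = (t.ann (t.parent v)).ncard ∧ (b = true ↔ t.ann v ≠ t.ann (t.parent v))) ∧
      ((¬ ∃ v, t.IsHead rep v ∧ rep v = s) → d.2 = none ∧
        ∀ v, t.IsLeaf v → s ∈ t.label v → d.1 = rep v) ∧
      ((¬ ∃ v, t.IsHead rep v ∧ rep v = s) → (¬ ∃ v, t.IsLeaf v ∧ s ∈ t.label v) → d.1 = s) := by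
    intro s
    by_cases hs : ∃ v, t.IsHead rep v ∧ rep v = s
    · obtain ⟨v, hv, rfl⟩ := hs
      have hpos : 0 < (t.ann (t.parent v)).ncard := by
        by_cases hr : v = t.root
        · rw [hr, parent_root, t.ann_root]
          rw [Set.ncard_univ, Nat.card_eq_fintype_card, Fintype.card_fin]
          exact hk
        · obtain ⟨u, -, -, -, hu⟩ :=
            t.ann_strict _ (t.parent_mem_nodes hv.1) ⟨v, hv.1, hr, rfl⟩
          exact (Nat.zero_le _).trans_lt (Set.ncard_lt_ncard hu)
      have hle := t.ncard_ann_le (t.parent v)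
      refine ⟨(rep (t.parent v), some (⟨(t.ann (t.parent v)).ncard - 1, by omega⟩,
        decide (t.ann v ≠ t.ann (t.parent v)), g (rep v))), ?_, fun h' => absurd ⟨v, hv, rfl⟩ h',
        fun h' => absurd ⟨v, hv, rfl⟩ h'⟩
      intro w hw hrep
      obtain rfl := h.head_unique hw hv hrep
      refine ⟨_, _, rfl, ?_, by simp⟩
      change (t.ann (t.parent w)).ncard - 1 + 1 = _
      omega
    · by_cases hl : ∃ v, t.IsLeaf v ∧ s ∈ t.label v
      · obtain ⟨v, hv, hsv⟩ := hl
        refine ⟨(rep v, none), fun w hw hr => absurd ⟨w, hw, hr⟩ hs,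
          fun _ => ⟨rfl, fun w hw hsw => ?_⟩, fun _ h' => absurd ⟨v, hv, hsv⟩ h'⟩
        rw [t.isLeaf_unique hw hv hsw hsv]
      · exact ⟨(s, none), fun w hw hr => absurd ⟨w, hw, hr⟩ hs,
          fun _ => ⟨rfl, fun w hw hsw => absurd ⟨w, hw, hsw⟩ hl⟩, fun _ _ => rfl⟩
  choose c hc1 hc2 hc3 using hc
  refine ⟨c, ⟨?_, ?_, ?_, ?_⟩⟩
  · intro v hv
    obtain ⟨i, b, h1, h2, h3⟩ := hc1 _ v hv rfl
    exact ⟨i, b, _, h1, h2, h3⟩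
  · intro s p i b g' hs
    by_contra hn
    have := (hc2 s hn).1
    simp [hs] at this
  · intro s p i b g' hs
    by_cases hn : ∃ v, t.IsHead rep v ∧ rep v = s
    · obtain ⟨v, hv, hr⟩ := hn
      obtain ⟨i', b', h1, -, -⟩ := hc1 s v hv hr
      rw [hs] at h1
      simp only [Prod.mk.injEq, Option.some.injEq] at h1
      rw [h1.2.2.2]
      exact hg s
    · have := (hc2 s hn).1
      simp [hs] at this
  · intro v hv s
    constructor
    · intro hs
      by_cases hn : ∃ w, t.IsHead rep w ∧ rep w = s
      · obtain ⟨w, hw, rfl⟩ := hn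
        obtain ⟨u, hu, hur⟩ := h.exists_isLeaf hw.1
        left
        rw [← hur, t.isLeaf_unique hu hv (hur ▸ h.mem u hu.1) hs]
      · right
        exact Prod.ext ((hc2 s hn).2 v hv hs) (hc2 s hn).1
    · rintro (rfl | hs)
      · exact h.mem v hv.1
      · by_cases hn : ∃ w, t.IsHead rep w ∧ rep w = s
        · obtain ⟨w, hw, hr⟩ := hn
          obtain ⟨i, b, h1, -⟩ := hc1 s w hw hr
          simp [hs] at h1
        · by_cases hl : ∃ u, t.IsLeaf u ∧ s ∈ t.label u
          · obtain ⟨u, hu, hsu⟩ := hl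
            have h1 := (hc2 s hn).2 u hu hsu
            rw [hs] at h1
            obtain rfl := t.isLeaf_unique hv hu (h.mem v hv.1) (by
              change rep v = rep u at h1
              rw [h1]; exact h.mem u hu.1)
            exact hsu
          · have h1 := hc3 s hn hl
            rw [hs] at h1
            obtain ⟨w, hw, hwr, -⟩ := IsRep.exists_head (rep := rep) hv.1
            exact absurd ⟨w, hw, hwr.trans h1⟩ hn

/-- The position of a node: its representative and the size of its annotation. -/
noncomputable def pos (t : CompactStreettSafraTree S n k) (rep : Fin (2 * (n * (k + 1))) → S)
    (v : Fin (2 * (n * (k + 1)))) : S × Fin (k + 1) :=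
  (rep v, ⟨(t.ann v).ncard, Nat.lt_succ_of_le (t.ncard_ann_le v)⟩)

lemma IsRep.exists_naming [Fintype S] {t : CompactStreettSafraTree S n k}
    {rep : Fin (2 * (n * (k + 1))) → S} (h : t.IsRep rep) (hcard : Fintype.card S = n) :
    ∃ e : S × Fin (k + 1) ≃ Finset.Icc 1 (n * (k + 1)),
      ∀ v ∈ t.nodes, (e (t.pos rep v) : ℕ) = t.name v := by
  classical
  have hinj : ∀ u ∈ t.nodes, ∀ v ∈ t.nodes, t.pos rep u = t.pos rep v → u = v := by
    intro u hu v hv huv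
    simp only [pos, Prod.mk.injEq, Fin.mk.injEq] at huv
    exact h.eq_of_ncard hu hv huv.1 huv.2
  let f : S × Fin (k + 1) → ℕ := fun x =>
    if hx : ∃ v ∈ t.nodes, t.pos rep v = x then t.name hx.choose else 0
  have hf : ∀ v ∈ t.nodes, f (t.pos rep v) = t.name v := by
    intro v hv
    have hx : ∃ w ∈ t.nodes, t.pos rep w = t.pos rep v := ⟨v, hv, rfl⟩
    change (if hx : _ then _ else _) = _
    rw [dif_pos hx, hinj _ hx.choose_spec.1 v hv hx.choose_spec.2]
  obtain ⟨e, he⟩ := Finset.exists_equiv_extend_of_card_eq (α := S × Fin (k + 1))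
    (t := Finset.Icc 1 (n * (k + 1))) (by simp [hcard]) (s := t.nodes.image (t.pos rep)) (f := f)
    (by
      intro y hy
      simp only [Finset.mem_image, exists_exists_and_eq_and] at hy
      obtain ⟨v, hv, rfl⟩ := hy
      rw [hf v hv, Finset.mem_Icc]
      exact ⟨(t.name_mem v hv).1, (t.name_mem v hv).2.1⟩)
    (by
      intro x hx y hy hxy
      simp only [Finset.coe_image, Set.mem_image, Finset.mem_coe] at hx hy
      obtain ⟨u, hu, rfl⟩ := hx
      obtain ⟨v, hv, rfl⟩ := hy
      rw [hf u hu, hf v hv] at hxy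
      rw [t.name_inj u hu v hv hxy])
  exact ⟨e, fun v hv => (he _ (Finset.mem_image_of_mem _ hv)).trans (hf v hv)⟩

/-- Trees with the same code and the same root representative have matching nodes. -/
lemma IsCode.exists_match {t₁ t₂ : CompactStreettSafraTree S n k}
    {rep₁ rep₂ : Fin (2 * (n * (k + 1))) → S}
    {c : S → S × Option (Fin k × Bool × (Fin k → Option (Fin k)))}
    (h₁ : t₁.IsRep rep₁) (h₂ : t₂.IsRep rep₂) (c₁ : t₁.IsCode rep₁ c) (c₂ : t₂.IsCode rep₂ c)
    (hroot : rep₁ t₁.root = rep₂ t₂.root) {v : Fin (2 * (n * (k + 1)))} (hv : v ∈ t₁.nodes) :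
    ∃ v' ∈ t₂.nodes, rep₁ v = rep₂ v' ∧ t₁.ann v = t₂.ann v' ∧ (v = t₁.root ↔ v' = t₂.root) ∧
      rep₁ (t₁.parent v) = rep₂ (t₂.parent v') ∧ t₁.ann (t₁.parent v) = t₂.ann (t₂.parent v') := by
  obtain ⟨a, ha⟩ := t₁.reaches_root v hv
  induction a generalizing v with
  | zero =>
    obtain rfl : v = t₁.root := ha
    refine ⟨t₂.root, t₂.root_mem, hroot, ?_, by simp, ?_, ?_⟩
    · rw [t₁.ann_root, t₂.ann_root]
    · rw [parent_root, parent_root, hroot]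
    · rw [parent_root, parent_root, t₁.ann_root, t₂.ann_root]
  | succ a ih =>
    by_cases hr : v = t₁.root
    · exact ih hv (by rw [hr, iterate_parent_root])
    have hpm := t₁.parent_mem v hv hr
    obtain ⟨p', hp', hrep, hann, -⟩ := ih hpm ha
    suffices hs : ∃ v' ∈ t₂.nodes, v' ≠ t₂.root ∧ rep₁ v = rep₂ v' ∧ t₁.ann v = t₂.ann v' ∧
        t₂.parent v' = p' by
      obtain ⟨v', hv', hr', h3, h4, h5⟩ := hs
      exact ⟨v', hv', h3, h4, by simp [hr, hr'], by rw [h5, hrep], by rw [h5, hann]⟩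
    by_cases hh : rep₁ (t₁.parent v) = rep₁ v
    · have hss := h₁.ann_ssubset_of_not_head hv hr hh
      obtain ⟨x, hx, hx'⟩ := Set.exists_of_ssubset hss
      have hcard := t₁.ncard_ann_add_one hv hr hx hx'
      have hk := t₁.ncard_ann_le (t₁.parent v)
      obtain ⟨u, hu, hur, huann⟩ := IsRep.exists_head (rep := rep₁) hpm
      obtain ⟨i, b, g, hc, hi, hb⟩ := c₁.head u hu
      rw [hur, hh] at hc
      have hg := (c₁.removed _ _ _ _ _ hc ⟨(t₁.ann v).ncard, by omega⟩ x).2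
        ⟨v, hv, hr, rfl, hx, hx', hcard⟩
      obtain ⟨w, hw, hwr, hwrep, hwx, hwx', hwl⟩ := (c₂.removed _ _ _ _ _ hc _ x).1 hg
      change (t₁.ann v).ncard + 1 = _ at hwl
      have hwp : rep₂ (t₂.parent w) = rep₂ w := by
        by_contra hne
        obtain ⟨i', b', g', hc', hi', hb'⟩ := c₂.head w ⟨hw, Or.inr hne⟩
        rw [hwrep, hc] at hc'
        simp only [Prod.mk.injEq, Option.some.injEq] at hc'
        obtain ⟨-, rfl, rfl, rfl⟩ := hc'
        have hbt : b = true := hb'.2 fun heq => hwx' (heq ▸ hwx)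
        have hne' := hb.1 hbt
        have hur' : u ≠ t₁.root := by
          rintro rfl
          exact hne' (by rw [parent_root])
        have h1 := Set.ncard_lt_ncard ((t₁.ann_sub u hu.1 hur').ssubset_of_ne hne')
        have h2 := Set.ncard_le_ncard huann
        omega
      have hpw : t₂.parent w = p' := by
        apply h₂.eq_of_ncard (t₂.parent_mem_nodes hw) hp'
        · rw [hwp, hwrep, ← hrep, hh]
        · rw [← hwl, hcard, hann]
      refine ⟨w, hw, hwr, hwrep.symm, ?_, hpw⟩
      rw [t₁.ann_eq_diff hv hr hx hx', t₂.ann_eq_diff hw hwr hwx hwx', hpw, hann]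
    · obtain ⟨i, b, g, hc, hi, hb⟩ := c₁.head v ⟨hv, Or.inr hh⟩
      obtain ⟨w, hw, hwrep⟩ := c₂.exists_head _ _ _ _ _ hc
      obtain ⟨i', b', g', hc', hi', hb'⟩ := c₂.head w hw
      rw [hwrep, hc] at hc'
      simp only [Prod.mk.injEq, Option.some.injEq] at hc'
      obtain ⟨hpr, rfl, rfl, rfl⟩ := hc'
      have hwr : w ≠ t₂.root := by
        rintro rfl
        rw [parent_root, hwrep] at hpr
        exact hh hpr
      have hpw : t₂.parent w = p' := by
        apply h₂.eq_of_ncard (t₂.parent_mem_nodes hw.1) hp'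
        · rw [← hpr, hrep]
        · rw [← hi', hi, hann]
      refine ⟨w, hw.1, hwr, hwrep.symm, ?_, hpw⟩
      by_cases hbt : b = true
      · have hss := (t₁.ann_sub v hv hr).ssubset_of_ne (hb.1 hbt)
        have hss' := (t₂.ann_sub w hw.1 hwr).ssubset_of_ne (hb'.1 hbt)
        obtain ⟨x, hx, hx'⟩ := Set.exists_of_ssubset hss
        obtain ⟨y, hy, hy'⟩ := Set.exists_of_ssubset hss'
        have hg := (c₁.removed _ _ _ _ _ hc i x).2 ⟨v, hv, hr, rfl, hx, hx', hi⟩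
        have hg' := (c₂.removed _ _ _ _ _ hc i y).2 ⟨w, hw.1, hwr, hwrep, hy, hy', hi'⟩
        obtain rfl : x = y := Option.some.inj (hg.symm.trans hg')
        rw [t₁.ann_eq_diff hv hr hx hx', t₂.ann_eq_diff hw.1 hwr hy hy', hpw, hann]
      · have e1 := not_not.1 (mt hb.2 hbt)
        have e2 := not_not.1 (mt hb'.2 hbt)
        rw [e1, e2, hpw, hann]

lemma IsCode.isLeaf_match {t₁ t₂ : CompactStreettSafraTree S n k}
    {rep₁ rep₂ : Fin (2 * (n * (k + 1))) → S}
    {c : S → S × Option (Fin k × Bool × (Fin k → Option (Fin k)))}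
    (h₁ : t₁.IsRep rep₁) (h₂ : t₂.IsRep rep₂) (c₁ : t₁.IsCode rep₁ c) (c₂ : t₂.IsCode rep₂ c)
    (hroot : rep₁ t₁.root = rep₂ t₂.root) {v v' : Fin (2 * (n * (k + 1)))} (hv : t₁.IsLeaf v)
    (hv' : v' ∈ t₂.nodes) (hrep : rep₁ v = rep₂ v') (hann : t₁.ann v = t₂.ann v') :
    t₂.IsLeaf v' := by
  refine ⟨hv', ?_⟩
  rintro ⟨u', hu', hur', rfl⟩
  obtain ⟨u, hu, -, -, h3, h4, h5⟩ := c₂.exists_match h₂ h₁ c₁ hroot.symm hu'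
  refine hv.2 ⟨u, hu, fun h => hur' (h3.2 h), ?_⟩
  apply h₁.eq_of_ncard (t₁.parent_mem_nodes hu) hv.1
  · rw [← h4, hrep]
  · rw [← h5, hann]

lemma IsCode.label_match {t₁ t₂ : CompactStreettSafraTree S n k}
    {rep₁ rep₂ : Fin (2 * (n * (k + 1))) → S}
    {c : S → S × Option (Fin k × Bool × (Fin k → Option (Fin k)))}
    (h₁ : t₁.IsRep rep₁) (h₂ : t₂.IsRep rep₂) (c₁ : t₁.IsCode rep₁ c) (c₂ : t₂.IsCode rep₂ c)
    (hroot : rep₁ t₁.root = rep₂ t₂.root) {v v' : Fin (2 * (n * (k + 1)))} (hv : v ∈ t₁.nodes)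
    (hv' : v' ∈ t₂.nodes) (hrep : rep₁ v = rep₂ v') (hann : t₁.ann v = t₂.ann v') :
    t₁.label v ⊆ t₂.label v' := by
  intro s hs
  obtain ⟨u, hu, hsu⟩ := t₁.exists_isLeaf hv hs
  obtain ⟨a, ha⟩ := t₁.exists_iterate_of_isLeaf hv hu hs hsu
  obtain ⟨u', hu', hur, hua, -⟩ := c₁.exists_match h₁ h₂ c₂ hroot hu.1
  have hl := c₁.isLeaf_match h₁ h₂ c₂ hroot hu hu' hur hua
  have hsu' : s ∈ t₂.label u' := by
    rw [c₂.leaf u' hl, ← hur]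
    exact (c₁.leaf u hu s).1 hsu
  have key : ∀ a w w', w ∈ t₁.nodes → w' ∈ t₂.nodes → rep₁ w = rep₂ w' → t₁.ann w = t₂.ann w' →
      t₁.parent^[a] w = v → t₂.parent^[a] w' = v' := by
    intro a
    induction a with
    | zero =>
      intro w w' _ hw' hr hwa hwv
      obtain rfl : w = v := hwv
      exact h₂.eq_of_ncard hw' hv' (hr.symm.trans hrep) (congrArg Set.ncard (hwa.symm.trans hann))
    | succ a ih =>
      intro w w' hw hw' hr ha hwv
      obtain ⟨w'', hw'', hr', ha', -, hpr, hpa⟩ := c₁.exists_match h₁ h₂ c₂ hroot hw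
      obtain rfl := h₂.eq_of_ncard hw' hw'' (hr.symm.trans hr') (by rw [← ha, ha'])
      exact ih _ _ (t₁.parent_mem_nodes hw) (t₂.parent_mem_nodes hw') hpr hpa hwv
  rw [← key a u u' hu.1 hu' hur hua ha]
  exact t₂.label_subset_iterate a hu' hsu'

/-- The data of the identification is monotone along equality of codes and namings. -/
lemma IsCode.named_le {t₁ t₂ : CompactStreettSafraTree S n k}
    {rep₁ rep₂ : Fin (2 * (n * (k + 1))) → S}
    {c : S → S × Option (Fin k × Bool × (Fin k → Option (Fin k)))}
    {e : S × Fin (k + 1) ≃ Finset.Icc 1 (n * (k + 1))}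
    (h₁ : t₁.IsRep rep₁) (h₂ : t₂.IsRep rep₂) (c₁ : t₁.IsCode rep₁ c) (c₂ : t₂.IsCode rep₂ c)
    (hroot : rep₁ t₁.root = rep₂ t₂.root)
    (e₁ : ∀ v ∈ t₁.nodes, (e (t₁.pos rep₁ v) : ℕ) = t₁.name v)
    (e₂ : ∀ v ∈ t₂.nodes, (e (t₂.pos rep₂ v) : ℕ) = t₂.name v) :
    t₁.namedParent ≤ t₂.namedParent ∧ t₁.namedLabel ≤ t₂.namedLabel ∧
      t₁.namedAnn ≤ t₂.namedAnn := by
  have hname : ∀ v v', v ∈ t₁.nodes → v' ∈ t₂.nodes → rep₁ v = rep₂ v' →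
      t₁.ann v = t₂.ann v' → t₂.name v' = t₁.name v := by
    intro v v' hv hv' hr ha
    rw [← e₁ v hv, ← e₂ v' hv']
    simp only [pos, hr, ha]
  refine ⟨?_, ?_, ?_⟩
  · rintro a b ⟨u, hu, hur, rfl, rfl⟩
    obtain ⟨u', hu', hr, ha, hiff, hpr, hpa⟩ := c₁.exists_match h₁ h₂ c₂ hroot hu
    exact ⟨u', hu', fun h => hur (hiff.2 h), hname u u' hu hu' hr ha,
      hname _ _ (t₁.parent_mem_nodes hu) (t₂.parent_mem_nodes hu') hpr hpa⟩
  · rintro a s ⟨v, hv, rfl, hs⟩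
    obtain ⟨v', hv', hr, ha, -⟩ := c₁.exists_match h₁ h₂ c₂ hroot hv
    exact ⟨v', hv', hname v v' hv hv' hr ha, c₁.label_match h₁ h₂ c₂ hroot hv hv' hr ha hs⟩
  · rintro a s ⟨v, hv, rfl, hs⟩
    obtain ⟨v', hv', hr, ha, -⟩ := c₁.exists_match h₁ h₂ c₂ hroot hv
    exact ⟨v', hv', hname v v' hv hv' hr ha, ha ▸ hs⟩

/-- The removal sequences below a position with `i + 1` annotation elements; if `b` holds, the first
step removes an element. -/
def chainCodes (k : ℕ) (i : Fin k) (b : Bool) : Finset (Fin k → Option (Fin k)) :=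
  Fintype.piFinset fun l =>
    if l < i then Finset.univ
    else if l = i then (if b then Finset.univ.erase none else Finset.univ)
    else {none}

/-- The codes of a single state. -/
def stateCodes (k : ℕ) : Finset (Option (Fin k × Bool × (Fin k → Option (Fin k)))) :=
  insert none (Finset.univ.biUnion fun i => Finset.univ.biUnion fun b =>
    (chainCodes k i b).image fun g => some (i, b, g))

/-- The codes of the representative of the root. -/
def rootCodes (k : ℕ) : Finset (Option (Fin k × Bool × (Fin k → Option (Fin k)))) :=
  (Finset.univ.filter fun i : Fin k => (i : ℕ) + 1 = k).biUnion fun i =>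
    Finset.univ.image fun g => some (i, false, g)

lemma IsCode.mem_stateCodes {t : CompactStreettSafraTree S n k}
    {rep : Fin (2 * (n * (k + 1))) → S}
    {c : S → S × Option (Fin k × Bool × (Fin k → Option (Fin k)))}
    (h : t.IsRep rep) (hc : t.IsCode rep c) (s : S) : (c s).2 ∈ stateCodes k := by
  rcases hs : c s with ⟨p, _ | ⟨i, b, g⟩⟩
  · simp [stateCodes]
  · suffices hg : g ∈ chainCodes k i b by
      simp only [stateCodes, Finset.mem_insert, Finset.mem_biUnion, Finset.mem_image]
      exact Or.inr ⟨i, Finset.mem_univ _, b, Finset.mem_univ _, g, hg, rfl⟩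
    obtain ⟨v, hv, rfl⟩ := hc.exists_head _ _ _ _ _ hs
    obtain ⟨i', b', g', hs', hi, hb⟩ := hc.head v hv
    rw [hs] at hs'
    simp only [Prod.mk.injEq, Option.some.injEq] at hs'
    obtain ⟨-, rfl, rfl, rfl⟩ := hs'
    have hrem := hc.removed _ _ _ _ _ hs
    rw [chainCodes, Fintype.mem_piFinset]
    intro l
    split_ifs with h1 h2 h3
    · simp
    · rw [Finset.mem_erase]
      refine ⟨?_, Finset.mem_univ _⟩
      have hne := hb.1 h3
      have hr : v ≠ t.root := by
        rintro rfl
        exact hne (by rw [parent_root])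
      obtain ⟨x, hx, hx'⟩ := Set.exists_of_ssubset ((t.ann_sub v hv.1 hr).ssubset_of_ne hne)
      rw [h2, (hrem i x).2 ⟨v, hv.1, hr, rfl, hx, hx', hi⟩]
      simp
    · simp
    · rw [Finset.mem_singleton]
      by_contra hne
      obtain ⟨x, hx⟩ := Option.ne_none_iff_exists'.1 hne
      obtain ⟨u, hu, hur, hrep, -, -, hl⟩ := (hrem l x).1 hx
      have hle : (t.ann (t.parent u)).ncard ≤ (t.ann (t.parent v)).ncard := by
        by_cases hh : rep (t.parent u) = rep u
        · refine (Set.ncard_le_ncard (h.ann_subset_head hv (t.parent_mem_nodes hu)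
            (hrep.symm.trans hh.symm))).trans ?_
          by_cases hvr : v = t.root
          · rw [hvr, parent_root]
          · exact Set.ncard_le_ncard (t.ann_sub v hv.1 hvr)
        · rw [h.head_unique ⟨hu, Or.inr hh⟩ hv hrep]
      have : l ≤ i := by
        rw [Fin.le_def]
        omega
      exact (lt_or_eq_of_le this).elim h1 h2

lemma IsCode.root {t : CompactStreettSafraTree S n k}
    {rep : Fin (2 * (n * (k + 1))) → S}
    {c : S → S × Option (Fin k × Bool × (Fin k → Option (Fin k)))}
    (hc : t.IsCode rep c) :
    c (rep t.root) ∈ ({rep t.root} : Finset S) ×ˢ rootCodes k := by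
  obtain ⟨i, b, g, h1, h2, h3⟩ := hc.head t.root ⟨t.root_mem, Or.inl rfl⟩
  rw [parent_root] at h1 h2 h3
  have hb : b = false := by simpa using h3
  rw [t.ann_root, Set.ncard_univ, Nat.card_eq_fintype_card, Fintype.card_fin] at h2
  simp [h1, hb, rootCodes, h2]

lemma card_rootCodes (k : ℕ) : (rootCodes k).card ≤ (k + 1) ^ k := by
  have h1 : (Finset.univ.filter fun i : Fin k => (i : ℕ) + 1 = k).card ≤ 1 := by
    rw [Finset.card_le_one]
    intro a ha b hb
    simp only [Finset.mem_filter, Finset.mem_univ, true_and] at ha hb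
    ext
    omega
  refine (Finset.card_biUnion_le_card_mul _ _ ((k + 1) ^ k) ?_).trans ?_
  · intro i _
    refine Finset.card_image_le.trans ?_
    simp
  · exact (Nat.mul_le_mul_right _ h1).trans (by simp)

lemma card_chainCodes (k : ℕ) (i : Fin k) (b : Bool) :
    (chainCodes k i b).card = (k + 1) ^ (i : ℕ) * (if b then k else k + 1) := by
  rw [chainCodes, Fintype.card_piFinset]
  have : ∀ l : Fin k, (if l < i then (Finset.univ : Finset (Option (Fin k)))
      else if l = i then (if b then Finset.univ.erase none else Finset.univ) else {none}).card =
      (if l < i then k + 1 else 1) * (if l = i then (if b then k else k + 1) else 1) := by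
    intro l
    split_ifs with h1 h2 h3 h4 <;> simp_all
  rw [Finset.prod_congr rfl fun l _ => this l, Finset.prod_mul_distrib, Finset.prod_ite_eq',
    Finset.prod_ite]
  have hi : (Finset.univ.filter fun l : Fin k => l < i).card = i := by
    rw [← Fin.card_Iio i]
    congr 1
    ext l
    simp
  simp [hi]

lemma one_add_sum_le {k : ℕ} (hk : 1 ≤ k) :
    1 + ∑ i ∈ Finset.range k, ((k + 1) ^ i * k + (k + 1) ^ i * (k + 1)) ≤ (k + 1) ^ (k + 1) := by
  have h1 : ∀ j, 1 + ∑ i ∈ Finset.range j, (k + 1) ^ i * k = (k + 1) ^ j := by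
    intro j
    induction j with
    | zero => simp
    | succ j ih => rw [Finset.sum_range_succ, ← add_assoc, ih]; ring
  have h2 : ∑ i ∈ Finset.range k, (k + 1) ^ i * (k + 1) ≤ (k + 1) ^ k * k := by
    calc _ ≤ ∑ i ∈ Finset.range k, (k + 1) ^ k := by
          refine Finset.sum_le_sum fun i hi => ?_
          rw [← pow_succ]
          exact Nat.pow_le_pow_right (by omega) (Finset.mem_range.1 hi)
      _ = _ := by simp [mul_comm]
  rw [Finset.sum_add_distrib, ← add_assoc, h1, pow_succ]
  linarith

lemma card_stateCodes {k : ℕ} (hk : 1 ≤ k) : (stateCodes k).card ≤ (k + 1) ^ (k + 1) := by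
  refine le_trans ?_ (one_add_sum_le hk)
  refine (Finset.card_insert_le _ _).trans ?_
  rw [add_comm]
  refine Nat.add_le_add_left ?_ 1
  refine Finset.card_biUnion_le.trans ?_
  rw [← Fin.sum_univ_eq_sum_range fun i => (k + 1) ^ i * k + (k + 1) ^ i * (k + 1)]
  refine Finset.sum_le_sum fun i _ => ?_
  refine Finset.card_biUnion_le.trans ?_
  refine (Finset.sum_le_sum fun b _ => Finset.card_image_le).trans ?_
  simp [card_chainCodes]

/-- The bijections with a prescribed value at one point. -/
lemma card_equiv_apply_eq_mul {α β : Type*} [Fintype α] [Fintype β] [DecidableEq α]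
    [DecidableEq β] (hαβ : Fintype.card α = Fintype.card β) (a : α) (b : β) :
    (Finset.univ.filter fun e : α ≃ β => e a = b).card * Fintype.card β ≤
      (Fintype.card β).factorial := by
  have hcard : Fintype.card (α ≃ β) = (Fintype.card β).factorial := by
    rw [Fintype.card_equiv (Fintype.equivOfCardEq hαβ), hαβ]
  rw [← hcard, ← Finset.card_univ (α := β), ← Finset.card_product, ← Finset.card_univ (α := α ≃ β)]
  refine Finset.card_le_card_of_injOn (fun x => x.1.trans (Equiv.swap b x.2))
    (fun _ _ => Finset.mem_coe.2 (Finset.mem_univ _)) ?_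
  rintro ⟨e, i⟩ he ⟨e', i'⟩ he' h
  simp only [Finset.coe_product, Set.mem_prod, Finset.mem_coe, Finset.mem_filter,
    Finset.mem_univ, true_and, and_true] at he he'
  have hi := congrArg (fun f : α ≃ β => f a) h
  simp only [Equiv.trans_apply, he, he', Equiv.swap_apply_left] at hi
  subst hi
  refine Prod.ext ?_ rfl
  ext x
  have := congrArg (fun f : α ≃ β => f x) h
  simpa using this

/-- The possible codes, namings and acceptance data of trees whose root is represented by `s₀`. -/
noncomputable def dataFinset (S : Type) [Fintype S] [DecidableEq S] (n k : ℕ) (s₀ : S) :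
    Finset ((S → S × Option (Fin k × Bool × (Fin k → Option (Fin k)))) ×
      (S × Fin (k + 1) ≃ Finset.Icc 1 (n * (k + 1))) × Bool × ℕ) :=
  (Fintype.piFinset fun s =>
      if s = s₀ then ({s₀} : Finset S) ×ˢ rootCodes k else Finset.univ ×ˢ stateCodes k) ×ˢ
    (Finset.univ.filter fun e : S × Fin (k + 1) ≃ Finset.Icc 1 (n * (k + 1)) =>
      (e (s₀, Fin.last k) : ℕ) = 1) ×ˢ
    (Finset.univ ×ˢ Finset.Icc 1 (n * (k + 1) + 1))

lemma card_dataFinset_mul (S : Type) [Fintype S] [DecidableEq S] {n k : ℕ} (hn : 1 ≤ n)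
    (hk : 1 ≤ k) (hcard : Fintype.card S = n) (s₀ : S) :
    (dataFinset S n k s₀).card * n ≤
      2 * n ^ n * (k + 1) ^ (n * (k + 1)) * (n * (k + 1)).factorial := by
  obtain ⟨n, rfl⟩ : ∃ j, n = j + 1 := ⟨n - 1, by omega⟩
  set m := (n + 1) * (k + 1) with hm
  have hmpos : 1 ≤ m := Nat.mul_pos (by omega) (by omega)
  have hcode : (Fintype.piFinset fun s => if s = s₀ then ({s₀} : Finset S) ×ˢ rootCodes k
      else Finset.univ ×ˢ stateCodes k).card ≤
      (k + 1) ^ k * ((n + 1) * (k + 1) ^ (k + 1)) ^ n := by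
    rw [Fintype.card_piFinset, ← Finset.mul_prod_erase _ _ (Finset.mem_univ s₀)]
    refine Nat.mul_le_mul ?_ ?_
    · simpa using card_rootCodes k
    · refine (Finset.prod_le_pow_card _ _ ((n + 1) * (k + 1) ^ (k + 1)) ?_).trans ?_
      · intro s hs
        rw [if_neg (Finset.ne_of_mem_erase hs), Finset.card_product, Finset.card_univ, hcard]
        exact Nat.mul_le_mul_left _ (card_stateCodes hk)
      · rw [Finset.card_erase_of_mem (Finset.mem_univ _), Finset.card_univ, hcard]
        simp
  have hname : (Finset.univ.filter fun e : S × Fin (k + 1) ≃ Finset.Icc 1 m =>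
      (e (s₀, Fin.last k) : ℕ) = 1).card * m ≤ m.factorial := by
    have := card_equiv_apply_eq_mul (α := S × Fin (k + 1)) (β := Finset.Icc 1 m)
      (by simp [hcard, hm]) (s₀, Fin.last k) ⟨1, by simp [hmpos]⟩
    simpa [Subtype.ext_iff] using this
  have hacc : ((Finset.univ : Finset Bool) ×ˢ Finset.Icc 1 (m + 1)).card ≤ 2 * (m * (k + 1)) := by
    rw [Finset.card_product]
    simp only [Finset.card_univ, Fintype.card_bool, Nat.card_Icc]
    have : m * 2 ≤ m * (k + 1) := Nat.mul_le_mul_left _ (by omega)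
    omega
  rw [dataFinset, Finset.card_product, Finset.card_product]
  set B := (Finset.univ.filter fun e : S × Fin (k + 1) ≃ Finset.Icc 1 m =>
    (e (s₀, Fin.last k) : ℕ) = 1).card
  calc _ ≤ (k + 1) ^ k * ((n + 1) * (k + 1) ^ (k + 1)) ^ n * (B * (2 * (m * (k + 1)))) * (n + 1) :=
        Nat.mul_le_mul_right _ (Nat.mul_le_mul hcode (Nat.mul_le_mul_left _ hacc))
    _ = 2 * ((n + 1) ^ n * (n + 1)) * (((k + 1) ^ (k + 1)) ^ n * ((k + 1) ^ k * (k + 1))) *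
          (B * m) := by
        rw [mul_pow]; ring
    _ = 2 * (n + 1) ^ (n + 1) * (k + 1) ^ m * (B * m) := by
        rw [← pow_succ, ← pow_succ, ← pow_succ, ← pow_mul, hm, mul_comm (n + 1)]
    _ ≤ _ := Nat.mul_le_mul_left _ hname

lemma accData_mem (t : CompactStreettSafraTree S n k) :
    t.accData ∈ (Finset.univ : Finset Bool) ×ˢ Finset.Icc 1 (n * (k + 1) + 1) := by
  rw [Finset.mem_product, accData]
  split_ifs
  · exact ⟨Finset.mem_univ _, Finset.mem_Icc.2 t.e_mem⟩
  · exact ⟨Finset.mem_univ _, Finset.mem_Icc.2 t.f_mem⟩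

lemma pos_root (t : CompactStreettSafraTree S n k) (rep : Fin (2 * (n * (k + 1))) → S) :
    t.pos rep t.root = (rep t.root, Fin.last k) := by
  simp [pos, t.ann_root, Set.ncard_univ, Fin.ext_iff]

end CompactStreettSafraTree

/-- For every finite set `S` with `|S| = n ≥ 1` and every
`k ≥ 1`, the number of compact Streett Safra trees over `S` with index `k`,
counted up to the identification of trees with the same named tree structure,
the same labeling and annotation of names, and the same acceptance data, is at
most `2·n^n·(k+1)^{n(k+1)}·(n(k+1))!`. -/
theorem compactStreettSafraTree_count (S : Type) [Fintype S] (n k : ℕ)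
    (hn : 1 ≤ n) (hk : 1 ≤ k) (hcard : Fintype.card S = n) :
    Nat.card (Quotient (Setoid.ker (fun t : CompactStreettSafraTree S n k =>
      (t.namedParent, t.namedLabel, t.namedAnn, t.accData)))) ≤
      2 * n ^ n * (k + 1) ^ (n * (k + 1)) * (n * (k + 1)).factorial := by
  classical
  choose rep hrep using fun t : CompactStreettSafraTree S n k => t.exists_isRep
  choose c hc using fun t => (hrep t).exists_isCode hk
  choose e he using fun t => (hrep t).exists_naming hcard
  have hroot : ∀ t : CompactStreettSafraTree S n k,
      (e t (rep t t.root, Fin.last k) : ℕ) = 1 := fun t => by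
    rw [← t.pos_root, he t _ t.root_mem, t.name_root]
  let Z := Finset.univ.biUnion (CompactStreettSafraTree.dataFinset S n k)
  have hmem : ∀ t, (c t, e t, t.accData) ∈ Z := by
    intro t
    refine Finset.mem_biUnion.2 ⟨rep t t.root, Finset.mem_univ _, Finset.mem_product.2 ⟨?_,
      Finset.mem_product.2 ⟨by simpa using hroot t, t.accData_mem⟩⟩⟩
    rw [Fintype.mem_piFinset]
    intro s
    split_ifs with hs
    · exact hs ▸ (hc t).root
    · exact Finset.mem_product.2 ⟨Finset.mem_univ _, (hc t).mem_stateCodes (hrep t) s⟩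
  have hinj : ∀ t₁ t₂, (c t₁, e t₁, t₁.accData) = (c t₂, e t₂, t₂.accData) →
      (t₁.namedParent, t₁.namedLabel, t₁.namedAnn, t₁.accData) =
        (t₂.namedParent, t₂.namedLabel, t₂.namedAnn, t₂.accData) := by
    intro t₁ t₂ h
    simp only [Prod.mk.injEq] at h
    obtain ⟨h1, h2, h3⟩ := h
    have hr : rep t₁ t₁.root = rep t₂ t₂.root := by
      have := (hroot t₁).trans (hroot t₂).symm
      rw [h2] at this
      exact congrArg Prod.fst ((e t₂).injective (Subtype.ext this))
    have c₁ := hc t₁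
    have e₁ := he t₁
    rw [h1] at c₁
    rw [h2] at e₁
    obtain ⟨a1, a2, a3⟩ := c₁.named_le (hrep t₁) (hrep t₂) (hc t₂) hr e₁ (he t₂)
    obtain ⟨b1, b2, b3⟩ := (hc t₂).named_le (hrep t₂) (hrep t₁) c₁ hr.symm (he t₂) e₁
    rw [le_antisymm a1 b1, le_antisymm a2 b2, le_antisymm a3 b3, h3]
  have hle := Nat.card_le_card_of_injective
    (fun q : Quotient (Setoid.ker (fun t : CompactStreettSafraTree S n k =>
      (t.namedParent, t.namedLabel, t.namedAnn, t.accData))) =>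
      (⟨_, hmem q.out⟩ : Z)) (by
    intro q₁ q₂ h
    rw [← Quotient.out_eq q₁, ← Quotient.out_eq q₂]
    exact Quotient.sound (hinj _ _ (congrArg Subtype.val h)))
  refine hle.trans ?_
  rw [Nat.card_eq_fintype_card, Fintype.card_coe]
  have hsum : Z.card * n ≤
      2 * n ^ n * (k + 1) ^ (n * (k + 1)) * (n * (k + 1)).factorial * n := by
    refine (Nat.mul_le_mul_right n Finset.card_biUnion_le).trans ?_
    rw [Finset.sum_mul]
    refine (Finset.sum_le_card_nsmul _ _ _ fun s₀ _ =>
      CompactStreettSafraTree.card_dataFinset_mul S hn hk hcard s₀).trans ?_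
    rw [Finset.card_univ, hcard, smul_eq_mul, mul_comm]
  exact Nat.le_of_mul_le_mul_right hsum hn
end

section
/- Let S be a finite set with |S| = n and let T be a finite rooted tree equipped with a labeling l of its nodes by subsets of S such that the labels of any two siblings are disjoint and the label of every node is a proper superset of the union of the labels of its children. Then T has at most n nodes. -/
open Relation in
/-- If the parent function reaches the root from `v`, then `v` is a descendant of the root. -/
theorem reflTransGen_root_of_iterate_parent {ν : Type*} {root : ν} {parent : ν → ν} (m : ℕ) :
    ∀ v : ν, parent^[m] v = root →
      ReflTransGen (fun a b => b ≠ root ∧ parent b = a) root v := by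
  induction m with
  | zero =>
    rintro v rfl
    exact .refl
  | succ m ih =>
    intro v hv
    by_cases h : v = root
    · rw [h]
    · exact (ih (parent v) hv).tail ⟨h, rfl⟩

open Relation in
/-- Labels that grow towards the root: an element of a label lies in all ancestor labels. -/
theorem mem_label_of_reflTransGen {ν S : Type*} {R : ν → ν → Prop} {l : ν → Set S}
    (hsub : ∀ a b, R a b → l b ⊆ l a) {s : S} {a b : ν} (h : ReflTransGen R a b)
    (hs : s ∈ l b) : s ∈ l a := by
  induction h using ReflTransGen.head_induction_on with
  | refl => exact hs
  | head hac _ ih => exact hsub _ _ hac ih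

open Relation in
/-- If labels grow towards the root and sibling labels are disjoint, then two nodes whose labels
share an element are comparable in the ancestor order. -/
theorem reflTransGen_total_of_mem_label {ν S : Type*} {R : ν → ν → Prop} {l : ν → Set S}
    (hsub : ∀ a b, R a b → l b ⊆ l a)
    (hsib : ∀ a b c s, R a b → R a c → s ∈ l b → s ∈ l c → b = c)
    {root : ν} (hroot : ∀ v, ReflTransGen R root v) {s : S} {v w : ν}
    (hv : s ∈ l v) (hw : s ∈ l w) : ReflTransGen R v w ∨ ReflTransGen R w v := by
  induction hroot v with
  | refl => exact .inl (hroot w)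
  | @tail p v _ hpv ih =>
    rcases ih (hsub _ _ hpv hv) with h | h
    · rcases h.cases_head with rfl | ⟨c, hpc, hcw⟩
      · exact .inr (.single hpv)
      · obtain rfl := hsib p c v s hpc hpv (mem_label_of_reflTransGen hsub hcw hw) hv
        exact .inl hcw
    · exact .inr (h.tail hpv)

/-- Let `S` be a finite set with `|S| = n` and let `T` be a
finite rooted tree (a finite set `ν` of nodes with a distinguished root and a
parent function from which the root is reachable by iteration) equipped with a
labeling `l` of its nodes by subsets of `S` such that the labels of any two
siblings are disjoint and the label of every node is a proper superset of the
union of the labels of its children.  Then `T` has at most `n` nodes. -/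
theorem tree_size_le_states (S : Type) [Fintype S] (n : ℕ)
    (hcard : Fintype.card S = n)
    (ν : Type) [Fintype ν] (root : ν) (parent : ν → ν)
    (htree : ∀ v : ν, ∃ m : ℕ, parent^[m] v = root)
    (l : ν → Set S)
    (hproper : ∀ v : ν, {s | ∃ u : ν, u ≠ root ∧ parent u = v ∧ s ∈ l u} ⊂ l v)
    (hdisj : ∀ u u' : ν, u ≠ root → u' ≠ root → u ≠ u' → parent u = parent u' →
      l u ∩ l u' = ∅) :
    Fintype.card ν ≤ n := by
  have hsub : ∀ a b, (b ≠ root ∧ parent b = a) → l b ⊆ l a :=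
    fun a b hab s hs => (hproper a).1 ⟨b, hab.1, hab.2, hs⟩
  have hsib : ∀ a b c s, (b ≠ root ∧ parent b = a) → (c ≠ root ∧ parent c = a) →
      s ∈ l b → s ∈ l c → b = c := by
    intro a b c s hb hc hsb hsc
    by_contra hne
    have hmem : s ∈ l b ∩ l c := ⟨hsb, hsc⟩
    rw [hdisj b c hb.1 hc.1 hne (hb.2.trans hc.2.symm)] at hmem
    exact hmem
  have hroot : ∀ v, Relation.ReflTransGen (fun a b => b ≠ root ∧ parent b = a) root v :=
    fun v => (htree v).elim fun m hm => reflTransGen_root_of_iterate_parent m v hm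
  choose f hf hf' using fun v => Set.exists_of_ssubset (hproper v)
  have eq_of_ancestor : ∀ v w, f v = f w →
      Relation.ReflTransGen (fun a b => b ≠ root ∧ parent b = a) v w → v = w := by
    intro v w hvw h
    rcases h.cases_head with h | ⟨c, hvc, hcw⟩
    · exact h
    · refine absurd ⟨c, hvc.1, hvc.2, ?_⟩ (hf' v)
      exact hvw ▸ mem_label_of_reflTransGen hsub hcw (hf w)
  rw [← hcard]
  refine Fintype.card_le_of_injective f fun v w hvw => ?_
  rcases reflTransGen_total_of_mem_label hsub hsib hroot (hf v) (hvw ▸ hf w) with h | h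
  · exact eq_of_ancestor v w hvw h
  · exact (eq_of_ancestor w v hvw.symm h).symm
end

section
/- Let S be a finite set with |S| = n, let k ≥ 1, and let T be a finite rooted tree equipped with: a labeling l of its nodes by subsets of S such that the label of every node equals the union of the labels of its children, the labels of any two siblings are disjoint, and every node has a nonempty label; and an annotation h of its nodes by subsets of [k] = {1,…,k} such that h(root) = [k], the annotation of every node is contained in that of its parent and misses at most one element of the annotation of the parent, and every node that is not a leaf has at least one child with strictly smaller annotation. Then T has at most n(k+1) nodes. -/
/-- If a potential at every node strictly exceeds the sum of the potentials of its children, then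
the potential at the root bounds the number of nodes. -/
theorem card_le_of_sum_children_lt {ν : Type*} [Fintype ν] [DecidableEq ν] (root : ν)
    (parent : ν → ν) (f : ν → ℕ)
    (hf : ∀ v, ∑ u with u ≠ root ∧ parent u = v, f u < f v) :
    Fintype.card ν ≤ f root := by
  have hsum : ∑ v, (∑ u with u ≠ root ∧ parent u = v, f u + 1) ≤ ∑ v, f v :=
    Finset.sum_le_sum fun v _ => hf v
  have hfiber : ∑ v, ∑ u with u ≠ root ∧ parent u = v, f u = ∑ u with u ≠ root, f u := by
    simp only [← Finset.filter_filter]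
    exact Finset.sum_fiberwise _ parent f
  have hsplit : ∑ u with u ≠ root, f u + f root = ∑ v, f v := by
    rw [Finset.filter_ne']
    exact Finset.sum_erase_add _ _ (Finset.mem_univ root)
  rw [Finset.sum_add_distrib, hfiber] at hsum
  simp only [Finset.sum_const, Finset.card_univ, smul_eq_mul, mul_one] at hsum
  omega

/-- Pairwise disjoint subsets of a finite set `t` have cardinalities summing to at most that
of `t`. -/
theorem sum_ncard_le_ncard {ι S : Type*} [Finite S] (C : Finset ι) (l : ι → Set S) (t : Set S)
    (hl : ∀ u ∈ C, l u ⊆ t) (hd : ∀ u ∈ C, ∀ u' ∈ C, u ≠ u' → l u ∩ l u' = ∅) :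
    ∑ u ∈ C, (l u).ncard ≤ t.ncard := by
  classical
  have := Fintype.ofFinite S
  simp only [Set.ncard_eq_toFinset_card']
  rw [← Finset.card_biUnion]
  · refine Finset.card_le_card (Finset.biUnion_subset.2 fun u hu => ?_)
    exact Set.toFinset_subset_toFinset.2 (hl u hu)
  · intro u hu u' hu' huu'
    exact Set.disjoint_toFinset.2 (Set.disjoint_iff_inter_eq_empty.2 (hd u hu u' hu' huu'))


/-- Let `S` be a finite set with `|S| = n`, let `k ≥ 1`, and
let `T` be a finite rooted tree (a finite set `ν` of nodes with a distinguished
root and a parent function from which the root is reachable by iteration)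
equipped with: a labeling `l` of its nodes by subsets of `S` such that the
label of every node (with children) equals the union of the labels of its
children, the labels of any two siblings are disjoint, and every node has a
nonempty label; and an annotation `h` of its nodes by subsets of
`[k] = {1,…,k}` (encoded as `Fin k`) such that the annotation of the root is
`[k]`, the annotation of every node is contained in that of its parent and
misses at most one element of the annotation of the parent, and every node that
is not a leaf has at least one child with strictly smaller annotation.  Then
`T` has at most `n(k+1)` nodes. -/
theorem streett_tree_size_le (S : Type) [Fintype S] (n k : ℕ) (hk : 1 ≤ k)
    (hcard : Fintype.card S = n)
    (ν : Type) [Fintype ν] (root : ν) (parent : ν → ν)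
    (htree : ∀ v : ν, ∃ m : ℕ, parent^[m] v = root)
    (l : ν → Set S)
    (hne : ∀ v : ν, (l v).Nonempty)
    (hunion : ∀ v : ν, (∃ u : ν, u ≠ root ∧ parent u = v) →
      l v = {s | ∃ u : ν, u ≠ root ∧ parent u = v ∧ s ∈ l u})
    (hdisj : ∀ u u' : ν, u ≠ root → u' ≠ root → u ≠ u' → parent u = parent u' →
      l u ∩ l u' = ∅)
    (h : ν → Set (Fin k))
    (hroot : h root = Set.univ)
    (hsub : ∀ v : ν, v ≠ root → h v ⊆ h (parent v))
    (hmiss : ∀ v : ν, v ≠ root → ∀ a b : Fin k,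
      a ∈ h (parent v) → a ∉ h v → b ∈ h (parent v) → b ∉ h v → a = b)
    (hstrict : ∀ v : ν, (∃ u : ν, u ≠ root ∧ parent u = v) →
      ∃ u : ν, u ≠ root ∧ parent u = v ∧ h u ⊂ h v) :
    Fintype.card ν ≤ n * (k + 1) := by
  classical
  have hpos : ∀ v, 0 < (l v).ncard := fun v => (Set.ncard_pos).2 (hne v)
  have key := card_le_of_sum_children_lt root parent
    (fun v => (l v).ncard * ((h v).ncard + 1)) fun v => ?_
  · simpa [hroot, Set.ncard_univ, Nat.card_eq_fintype_card, hcard] using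
      key.trans (Nat.mul_le_mul_right _ (Set.ncard_le_ncard (Set.subset_univ (l root))))
  by_cases hv : ∃ u, u ≠ root ∧ parent u = v
  · obtain ⟨w, hw, hwv, hlt⟩ := hstrict v hv
    calc ∑ u with u ≠ root ∧ parent u = v, (l u).ncard * ((h u).ncard + 1)
        < ∑ u with u ≠ root ∧ parent u = v, (l u).ncard * ((h v).ncard + 1) := by
          refine Finset.sum_lt_sum (fun u hu => ?_) ⟨w, by simp [hw, hwv], ?_⟩
          · obtain ⟨hur, rfl⟩ := (Finset.mem_filter.1 hu).2
            exact Nat.mul_le_mul_left _ (Nat.succ_le_succ (Set.ncard_le_ncard (hsub u hur)))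
          · exact Nat.mul_lt_mul_of_pos_left (Nat.succ_lt_succ (Set.ncard_lt_ncard hlt)) (hpos w)
      _ ≤ (l v).ncard * ((h v).ncard + 1) := by
          rw [← Finset.sum_mul]
          refine Nat.mul_le_mul_right _ (sum_ncard_le_ncard _ l _ (fun u hu s hs => ?_) ?_)
          · rw [hunion v hv]
            obtain ⟨hu, huv⟩ := (Finset.mem_filter.1 hu).2
            exact ⟨u, hu, huv, hs⟩
          · intro u hu u' hu' huu'
            obtain ⟨hu, huv⟩ := (Finset.mem_filter.1 hu).2
            obtain ⟨hu', huv'⟩ := (Finset.mem_filter.1 hu').2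
            exact hdisj u u' hu hu' huu' (huv.trans huv'.symm)
  · rw [Finset.filter_false_of_mem fun u _ hu => hv ⟨u, hu⟩, Finset.sum_empty]
    exact Nat.mul_pos (hpos v) (Nat.succ_pos _)
end

section
/- Let N = ⟨Σ, S, δ, s₀, α⟩ be a nondeterministic Büchi word automaton and let w ∈ Σ^ω. Suppose there exist indices 0 < i₁ < i₂ < ⋯ and nonempty subsets L₁, L₂, … of S such that: (a) every s ∈ L₁ is reachable from s₀ reading w[0, i₁−1]; and (b) for every j ≥ 1 and every s' ∈ L_{j+1} there exists s ∈ L_j such that s' is reachable from s reading w[i_j, i_{j+1}−1] along a finite run that visits α. Then w ∈ L(N). -/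
/-- The set of states occurring infinitely often in an infinite sequence. -/
def InfOcc {S : Type} (r : ℕ → S) : Set S :=
  {s | ∀ N : ℕ, ∃ n, N ≤ n ∧ r n = s}

/-- `r` is a run of the nondeterministic automaton with transition function `δ`
and initial state `s0` on the infinite word `w`. -/
def IsRun {A S : Type} (δ : S → A → Set S) (s0 : S) (w : ℕ → A) (r : ℕ → S) : Prop :=
  r 0 = s0 ∧ ∀ j, r (j + 1) ∈ δ (r j) (w j)

/-- The language of a nondeterministic Büchi word automaton:
some run visits the acceptance set `acc` infinitely often. -/
def BuchiLang {A S : Type} (δ : S → A → Set S) (s0 : S) (acc : Set S) : Set (ℕ → A) :=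
  {w | ∃ r, IsRun δ s0 w r ∧ (InfOcc r ∩ acc).Nonempty}

/-- The language of a nondeterministic Streett word automaton with pairs
`⟨R i, G i⟩`: some run `r` satisfies, for every `i`,
`inf(r) ∩ G i = ∅` or `inf(r) ∩ R i ≠ ∅`. -/
def StreettLang {A S : Type} {k : ℕ} (δ : S → A → Set S) (s0 : S)
    (R G : Fin k → Set S) : Set (ℕ → A) :=
  {w | ∃ r, IsRun δ s0 w r ∧ ∀ i, InfOcc r ∩ G i = ∅ ∨ (InfOcc r ∩ R i).Nonempty}

/-- The unique run of a deterministic automaton with transition function `δ`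
and initial state `s0` on the infinite word `w`. -/
def DetRun {A S : Type} (δ : S → A → S) (s0 : S) (w : ℕ → A) : ℕ → S
  | 0 => s0
  | j + 1 => δ (DetRun δ s0 w j) (w j)

/-- `F` is a partition of the state space into `k` (possibly empty) classes. -/
def IsPartition {S : Type} {k : ℕ} (F : Fin k → Set S) : Prop :=
  (∀ i j : Fin k, i ≠ j → F i ∩ F j = ∅) ∧ (⋃ i, F i) = Set.univ

/-- A run is accepted by the parity condition `F 0, …, F (k-1)` iff the least
`i` such that `inf(r) ∩ F i ≠ ∅` is even. -/
def ParityAccept {S : Type} {k : ℕ} (F : Fin k → Set S) (r : ℕ → S) : Prop :=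
  ∃ i : Fin k, Even (i : ℕ) ∧ (InfOcc r ∩ F i).Nonempty ∧
    ∀ j : Fin k, j < i → InfOcc r ∩ F j = ∅

/-- A run is accepted by the Rabin condition with pairs `⟨E i, F i⟩` iff for
some `i`, `inf(r) ∩ E i = ∅` and `inf(r) ∩ F i ≠ ∅`. -/
def RabinAccept {S : Type} {k : ℕ} (E F : Fin k → Set S) (r : ℕ → S) : Prop :=
  ∃ i : Fin k, InfOcc r ∩ E i = ∅ ∧ (InfOcc r ∩ F i).Nonempty

/-- `δ(S', σ) = ⋃_{s ∈ S'} δ(s, σ)`: one transition step applied to a set of states. -/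
def DeltaSet {A S : Type} (δ : S → A → Set S) (T : Set S) (a : A) : Set S :=
  {t | ∃ s ∈ T, t ∈ δ s a}

/-- `δ(S', u)` for a finite word `u`: `δ(S', ε) = S'` and `δ(S', uσ) = δ(δ(S', u), σ)`.
A state `t` is reachable from `s` reading `u` iff `t ∈ DeltaWord δ {s} u`. -/
def DeltaWord {A S : Type} (δ : S → A → Set S) (T : Set S) (u : List A) : Set S :=
  u.foldl (DeltaSet δ) T

/-- `r` is a finite run reading the finite word `u` (only `r 0, …, r u.length`
are relevant): consecutive states are related by the transition function. -/
def IsFinRun {A S : Type} (δ : S → A → Set S) (u : List A) (r : ℕ → S) : Prop :=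
  ∀ (j : ℕ) (h : j < u.length), r (j + 1) ∈ δ (r j) (u.get ⟨j, h⟩)

/-- `r` is an initial run segment of length `n` on `w` from `s0`. -/
def IsRunUpTo {A S : Type} (δ : S → A → Set S) (s0 : S) (w : ℕ → A) (n : ℕ) (r : ℕ → S) : Prop :=
  r 0 = s0 ∧ ∀ j < n, r (j + 1) ∈ δ (r j) (w j)

theorem exists_isRunUpTo_of_mem_deltaWord {A S : Type} {δ : S → A → Set S} {s0 : S} {w : ℕ → A}
    (n : ℕ) {t : S} (ht : t ∈ DeltaWord δ {s0} ((List.range n).map w)) :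
    ∃ r, IsRunUpTo δ s0 w n r ∧ r n = t := by
  induction n generalizing t with
  | zero => exact ⟨fun _ => s0, ⟨rfl, by simp⟩, by simpa [DeltaWord, eq_comm] using ht⟩
  | succ n ih =>
    simp only [DeltaWord, List.range_succ, List.map_append, List.foldl_append, List.map_cons,
      List.map_nil, List.foldl_cons, List.foldl_nil] at ht
    obtain ⟨s, hs, hst⟩ := ht
    obtain ⟨r, ⟨h0, hstep⟩, rfl⟩ := ih hs
    refine ⟨fun m => if m ≤ n then r m else t, ⟨by simpa using h0, fun j hj => ?_⟩, by simp⟩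
    obtain hj' | rfl := Nat.lt_succ_iff_lt_or_eq.mp hj
    · simpa [hj'.le, Nat.succ_le_of_lt hj'] using hstep j hj'
    · simpa using hst

/-- Appending a finite run on the next `k` letters to an initial run segment of length `n`. -/
theorem IsRunUpTo.append {A S : Type} {δ : S → A → Set S} {s0 : S} {w : ℕ → A} {n k : ℕ}
    {r r' : ℕ → S} (hr : IsRunUpTo δ s0 w n r) (hglue : r' 0 = r n)
    (hr' : IsFinRun δ ((List.range k).map fun t => w (n + t)) r') :
    ∃ q, IsRunUpTo δ s0 w (n + k) q ∧ (∀ m ≤ n, q m = r m) ∧ ∀ m, q (n + m) = r' m := by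
  have hleft : ∀ m ≤ n, (if m ≤ n then r m else r' (m - n)) = r m := fun m hm => if_pos hm
  have hright : ∀ m, (if n + m ≤ n then r (n + m) else r' (n + m - n)) = r' m := by
    intro m
    rcases m with _ | m
    · simp [hglue]
    · simp
  refine ⟨fun m => if m ≤ n then r m else r' (m - n), ⟨?_, fun j hj => ?_⟩, hleft, hright⟩
  · simpa using hr.1
  · beta_reduce
    rcases lt_or_ge j n with hjn | hjn
    · rw [hleft j hjn.le, hleft (j + 1) hjn]
      exact hr.2 j hjn
    · obtain ⟨i, rfl⟩ := Nat.exists_eq_add_of_le hjn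
      rw [hright i, add_assoc, hright (i + 1)]
      simpa using hr' i (by simpa using hj)

theorem isClosed_setOf_isRunUpTo {A S : Type} [TopologicalSpace S] [DiscreteTopology S]
    (δ : S → A → Set S) (s0 : S) (w : ℕ → A) (n : ℕ) :
    IsClosed {r | IsRunUpTo δ s0 w n r} := by
  have hstart := (isClosed_discrete {s0}).preimage (continuous_apply (A := fun _ : ℕ => S) 0)
  have hstep : ∀ j, IsClosed {r : ℕ → S | r (j + 1) ∈ δ (r j) (w j)} := fun j => by
    have hcont : Continuous fun r : ℕ → S => (r j, r (j + 1)) := by fun_prop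
    exact (isClosed_discrete {p : S × S | p.2 ∈ δ p.1 (w j)}).preimage hcont
  convert hstart.inter (isClosed_iInter fun j => isClosed_iInter fun _ : j < n => hstep j) using 1
  ext r
  simp [IsRunUpTo]

theorem isClosed_setOf_exists_mem_Icc {S : Type} [TopologicalSpace S] [DiscreteTopology S]
    (acc : Set S) (a b : ℕ) : IsClosed {r : ℕ → S | ∃ m ∈ Set.Icc a b, r m ∈ acc} := by
  have h := (Set.finite_Icc a b).isClosed_biUnion
    fun m _ => (isClosed_discrete acc).preimage (continuous_apply (A := fun _ : ℕ => S) m)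
  convert h using 1
  ext r
  simp

theorem infOcc_inter_nonempty {S : Type} [Finite S] {r : ℕ → S} {acc : Set S}
    (h : ∀ N, ∃ n, N ≤ n ∧ r n ∈ acc) : (InfOcc r ∩ acc).Nonempty := by
  by_contra hne
  have hev : ∀ s, ∃ N, ∀ n, N ≤ n → r n = s → s ∉ acc := by
    intro s
    by_contra! hs
    obtain ⟨_, _, _, hacc⟩ := hs 0
    refine hne ⟨s, fun N => ?_, hacc⟩
    obtain ⟨n, hn, hrn, _⟩ := hs N
    exact ⟨n, hn, hrn⟩
  choose N hN using hev
  obtain ⟨M, hM⟩ := (Set.finite_range N).bddAbove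
  obtain ⟨n, hn, hacc⟩ := h M
  exact hN (r n) n ((hM ⟨_, rfl⟩).trans hn) rfl hacc

/-- Let `N` be an NBW and `w ∈ Σ^ω`.  Suppose there exist
indices `0 < i₁ < i₂ < ⋯` (given by `I j = i_{j+1}`) and nonempty subsets
`L₁, L₂, …` of `S` (given by `L j = L_{j+1}`) such that: (a) every `s ∈ L₁` is
reachable from `s₀` reading `w[0, i₁−1]`; and (b) for every `j ≥ 1` and every
`s' ∈ L_{j+1}` there exists `s ∈ L_j` such that `s'` is reachable from `s`
reading `w[i_j, i_{j+1}−1]` along a finite run that visits `α`.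
Then `w ∈ L(N)`. -/
theorem koenig_buchi_accept (A : Type) [Fintype A] (S : Type) [Fintype S]
    (δ : S → A → Set S) (s0 : S) (acc : Set S) (w : ℕ → A)
    (I : ℕ → ℕ) (L : ℕ → Set S)
    (hI0 : 0 < I 0) (hImono : StrictMono I)
    (hLne : ∀ j : ℕ, (L j).Nonempty)
    (ha : ∀ s ∈ L 0, s ∈ DeltaWord δ {s0} ((List.range (I 0)).map w))
    (hb : ∀ j : ℕ, ∀ s' ∈ L (j + 1), ∃ s ∈ L j, ∃ r : ℕ → S,
      r 0 = s ∧ r (I (j + 1) - I j) = s' ∧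
      IsFinRun δ ((List.range (I (j + 1) - I j)).map (fun t => w (I j + t))) r ∧
      ∃ j' ≤ I (j + 1) - I j, r j' ∈ acc) :
    w ∈ BuchiLang δ s0 acc := by
  have hrun : ∀ n, ∀ s ∈ L n, ∃ r, IsRunUpTo δ s0 w (I n) r ∧ r (I n) = s ∧
      ∀ k < n, ∃ m ∈ Set.Icc (I k) (I (k + 1)), r m ∈ acc := by
    intro n
    induction n with
    | zero =>
      intro s hs
      obtain ⟨r, hr, hrs⟩ := exists_isRunUpTo_of_mem_deltaWord _ (ha s hs)
      exact ⟨r, hr, hrs, by simp⟩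
    | succ n ih =>
      intro s' hs'
      obtain ⟨s, hs, r', hr0, hrend, hr', i, hi, hiacc⟩ := hb n s' hs'
      obtain ⟨r, hr, hrs, hvisit⟩ := ih s hs
      obtain ⟨q, hq, hqleft, hqright⟩ := hr.append (hr0.trans hrs.symm) hr'
      have hlt : I n < I (n + 1) := hImono n.lt_succ_self
      have hsum : I n + (I (n + 1) - I n) = I (n + 1) := by omega
      refine ⟨q, hsum ▸ hq, ?_, fun k hk => ?_⟩
      · rw [← hrend, ← hqright, hsum]
      · obtain hk' | rfl := Nat.lt_succ_iff_lt_or_eq.mp hk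
        · obtain ⟨m, hm, hmacc⟩ := hvisit k hk'
          refine ⟨m, hm, ?_⟩
          rwa [hqleft m (hm.2.trans (hImono.monotone hk'))]
        · exact ⟨I k + i, ⟨by omega, by omega⟩, by rwa [hqright]⟩
  let C : ℕ → Set (ℕ → S) := fun n => {r | IsRunUpTo δ s0 w (I n) r} ∩
    ⋂ k, ⋂ (_ : k < n), {r | ∃ m ∈ Set.Icc (I k) (I (k + 1)), r m ∈ acc}
  let _ : TopologicalSpace S := ⊥
  have : DiscreteTopology S := ⟨rfl⟩
  have hclosed : ∀ n, IsClosed (C n) := fun n =>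
    (isClosed_setOf_isRunUpTo δ s0 w (I n)).inter <|
      isClosed_iInter fun k => isClosed_iInter fun _ => isClosed_setOf_exists_mem_Icc acc _ _
  obtain ⟨r, hr⟩ : (⋂ n, C n).Nonempty := by
    refine IsCompact.nonempty_iInter_of_sequence_nonempty_isCompact_isClosed C (fun n => ?_)
      (fun n => ?_) (hclosed 0).isCompact hclosed
    · rintro r ⟨⟨h0, hstep⟩, hvisit⟩
      simp only [Set.mem_iInter] at hvisit
      refine ⟨⟨h0, fun j hj => hstep j (hj.trans (hImono n.lt_succ_self))⟩, ?_⟩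
      simp only [Set.mem_iInter]
      exact fun k hk => hvisit k (hk.trans n.lt_succ_self)
    · obtain ⟨s, hs⟩ := hLne n
      obtain ⟨r, hr, -, hvisit⟩ := hrun n s hs
      exact ⟨r, hr, by simpa only [Set.mem_iInter, Set.mem_ofPred_eq] using hvisit⟩
  rw [Set.mem_iInter] at hr
  refine ⟨r, ⟨(hr 0).1.1, fun j => (hr (j + 1)).1.2 j (hImono.le_apply (x := j + 1))⟩, ?_⟩
  refine infOcc_inter_nonempty fun N => ?_
  have hvisit := (hr (N + 1)).2
  simp only [Set.mem_iInter] at hvisit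
  obtain ⟨m, hm, hmacc⟩ := hvisit N N.lt_succ_self
  exact ⟨m, hImono.le_apply.trans hm.1, hmacc⟩
end

section
/- For every k ≥ 1 there exists a nondeterministic Büchi word automaton with k states over the alphabet [k] = {1,…,k} whose language is L_k = { w ∈ [k]^ω | min(inf(w)) is even }, where inf(w) is the set of letters occurring infinitely often in w. -/
/-- Transitions of the Büchi automaton requiring the least letter seen infinitely often to be odd.
State `0` waits; for odd `p`, the states `p` and `p + 1` read only letters `≥ p`, and `p` is
entered exactly on reading the letter `p`. -/
def minParityStep {k : ℕ} (s a : Fin k) : Set (Fin k) :=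
  {t | ((s : ℕ) = 0 ∧ (t : ℕ) = 0) ∨
    ∃ p : ℕ, Odd p ∧ ((s : ℕ) = 0 ∨ (s : ℕ) = p ∨ (s : ℕ) = p + 1) ∧
      (((t : ℕ) = p ∧ (a : ℕ) = p) ∨ ((t : ℕ) = p + 1 ∧ p < (a : ℕ)))}

/-- An odd state is entered only by reading the letter of the same value. -/
lemma minParityStep_letter_eq {k : ℕ} {s a t : Fin k} (h : t ∈ minParityStep s a)
    (ht : Odd (t : ℕ)) : a = t := by
  rw [Fin.ext_iff]
  rw [Nat.odd_iff] at ht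
  rcases h with h | ⟨p, hp, -, h⟩
  · omega
  · rw [Nat.odd_iff] at hp
    omega

/-- From `p` or `p + 1` with `p` odd, only letters `≥ p` can be read, and the next state is again
`p` or `p + 1`. -/
lemma minParityStep_stay {k p : ℕ} {s a t : Fin k} (hp : Odd p) (h : t ∈ minParityStep s a)
    (hs : (s : ℕ) = p ∨ (s : ℕ) = p + 1) :
    p ≤ (a : ℕ) ∧ ((t : ℕ) = p ∨ (t : ℕ) = p + 1) := by
  rw [Nat.odd_iff] at hp
  rcases h with h | ⟨q, hq, h⟩
  · omega
  · rw [Nat.odd_iff] at hq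
    omega

/-- If no letter below `i` occurs infinitely often, then eventually all letters are `≥ i`. -/
lemma exists_forall_le_of_infOcc {k : ℕ} {w : ℕ → Fin k} {i : Fin k}
    (h : ∀ j ∈ InfOcc w, (i : ℕ) ≤ (j : ℕ)) : ∃ N, ∀ n, N ≤ n → i ≤ w n := by
  have key : ∀ j : Fin k, ∃ N, ∀ n, N ≤ n → j < i → w n ≠ j := by
    intro j
    by_contra! hc
    obtain ⟨-, -, hlt, -⟩ := hc 0
    have hj : j ∈ InfOcc w := fun N => by
      obtain ⟨n, hn, -, hw⟩ := hc N
      exact ⟨n, hn, hw⟩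
    exact absurd hlt (not_lt.mpr (h j hj))
  choose N hN using key
  refine ⟨Finset.univ.sup N, fun n hn => ?_⟩
  by_contra! hlt
  exact hN (w n) n ((Finset.le_sup (Finset.mem_univ _)).trans hn) hlt rfl

/-- For every `k ≥ 1` there exists a nondeterministic Büchi
word automaton with `k` states over the alphabet `[k] = {1,…,k}` whose language
is `L_k = { w ∈ [k]^ω | min(inf(w)) is even }`.  The alphabet `[k]` is encoded
as `Fin k`, the letter `i : Fin k` representing the number `(i : ℕ) + 1 ∈ [k]`;
`min(inf(w))` is even is expressed as: some letter `i` occurring infinitely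
often in `w` is ≤ all letters occurring infinitely often in `w` and has even
value `(i : ℕ) + 1`. -/
theorem nbw_for_min_inf_even (k : ℕ) (hk : 1 ≤ k) :
    ∃ (δ : Fin k → Fin k → Set (Fin k)) (s0 : Fin k) (acc : Set (Fin k)),
      BuchiLang δ s0 acc =
        {w : ℕ → Fin k | ∃ i ∈ InfOcc w,
          (∀ j ∈ InfOcc w, (i : ℕ) ≤ (j : ℕ)) ∧ Even ((i : ℕ) + 1)} := by
  refine ⟨minParityStep, ⟨0, hk⟩, {t | Odd (t : ℕ)}, Set.ext fun w => ⟨?_, ?_⟩⟩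
  · rintro ⟨r, ⟨-, hr⟩, p, hpr, hp⟩
    have hp : Odd (p : ℕ) := hp
    refine ⟨p, fun N => ?_, fun j hj => ?_, hp.add_one⟩
    · obtain ⟨n, hn, rfl⟩ := hpr (N + 1)
      obtain ⟨m, rfl⟩ : ∃ m, n = m + 1 := ⟨n - 1, by omega⟩
      exact ⟨m, by omega, minParityStep_letter_eq (hr m) hp⟩
    · obtain ⟨n, -, hn⟩ := hpr 0
      have stay : ∀ m, n ≤ m → (r m : ℕ) = p ∨ (r m : ℕ) = p + 1 := by
        intro m hm
        induction m, hm using Nat.le_induction with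
        | base => exact Or.inl (by rw [hn])
        | succ m _ ih => exact (minParityStep_stay hp (hr m) ih).2
      obtain ⟨m, hm, rfl⟩ := hj n
      exact (minParityStep_stay hp (hr m) (stay m hm)).1
  · rintro ⟨i, hi, hmin, heven⟩
    have hodd : Odd (i : ℕ) := by
      rw [Nat.even_iff] at heven
      rw [Nat.odd_iff]
      omega
    obtain ⟨N, hN⟩ := exists_forall_le_of_infOcc hmin
    let r (n : ℕ) : Fin k := if n ≤ N then ⟨0, hk⟩ else if w (n - 1) = i then i else
      ⟨min ((i : ℕ) + 1) (k - 1), (min_le_right _ _).trans_lt (Nat.sub_lt hk one_pos)⟩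
    have r_early (m : ℕ) (hm : m ≤ N) : r m = ⟨0, hk⟩ := if_pos hm
    have r_succ (m : ℕ) (hm : N ≤ m) : r (m + 1) = if w m = i then i else
        ⟨min ((i : ℕ) + 1) (k - 1), (min_le_right _ _).trans_lt (Nat.sub_lt hk one_pos)⟩ :=
      if_neg (by omega)
    have r_late (m : ℕ) (hm : N ≤ m) : ((r (m + 1) : ℕ) = i ∧ (w m : ℕ) = i) ∨
        ((r (m + 1) : ℕ) = i + 1 ∧ (i : ℕ) < w m) := by
      rw [r_succ m hm]
      split_ifs with h
      · exact Or.inl ⟨rfl, by rw [h]⟩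
      · have hlt : (i : ℕ) < w m := Fin.lt_def.mp ((hN m hm).lt_of_ne (Ne.symm h))
        have := (w m).isLt
        exact Or.inr ⟨by simp only; omega, hlt⟩
    refine ⟨r, ⟨r_early 0 N.zero_le, fun m => ?_⟩, i, fun M => ?_, hodd⟩
    · rcases lt_or_ge m N with hm | hm
      · exact Or.inl ⟨by rw [r_early m hm.le], by rw [r_early (m + 1) hm]⟩
      · refine Or.inr ⟨i, hodd, ?_, r_late m hm⟩
        rcases hm.eq_or_lt with rfl | hlt
        · exact Or.inl (by rw [r_early _ le_rfl])
        · obtain ⟨l, rfl⟩ : ∃ l, m = l + 1 := ⟨m - 1, by omega⟩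
          exact Or.inr ((r_late l (by omega)).imp And.left And.left)
    · obtain ⟨n, hn, hw⟩ := hi (M + N)
      exact ⟨n + 1, by omega, by rw [r_succ n (by omega), if_pos hw]⟩
end
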